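/- arXiv:1806.07586 — 2 statements merged into one kernel-verified Lean document; each statement's English description precedes it below -/
import Mathlib

section
/- The sum, over all mixed triples (X, M₁, M₂), of (−1)^{|X∩A′|} · (∏_{e∈M₁} w(e)) · (∏_{e∈M₂} w(e)) equals 0 in R. -/
/-!
STATEMENT 1.  In the setting of perfect matchings of the induced subgraphs `H(X)` and
`H(W ∖ X)` (for `X ⊆ W`, where `W = A′ ∪ B′` is partitioned into `A′` and `B′`),
a triple `(X, M₁, M₂)` is *mixed* if some connected component of the graph with edge
set `M₁ Δ M₂` is a path with one endpoint in `A′` and the other endpoint in `B′`.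
The sum over all mixed triples of `(−1)^{|X∩A′|} · (∏_{e∈M₁} w e) · (∏_{e∈M₂} w e)`
equals `0` in the commutative ring `R`.
-/

/-- The vertex set of the induced subgraph `H(X)`: all non-`W` vertices together
with `X`. -/
def inducedVerts {V : Type} (W X : Finset V) : Set V := (↑W : Set V)ᶜ ∪ ↑X

/-- `M` is (the edge set of) a perfect matching of the subgraph of `H` induced on the
vertex set `S`. -/
def IsPMon {V : Type} (H : SimpleGraph V) (S : Set V) (M : Finset (Sym2 V)) : Prop :=
  (∀ e ∈ M, e ∈ H.edgeSet ∧ ∀ x ∈ e, x ∈ S) ∧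
  (∀ x ∈ S, ∃! e, e ∈ M ∧ x ∈ e)

/-- The edges of the connected component of `x` in the graph `D`. -/
def compEdges {V : Type} (D : SimpleGraph V) (x : V) : Set (Sym2 V) :=
  {e | e ∈ D.edgeSet ∧ ∃ y ∈ e, D.Reachable x y}

/-- A pair of matchings is *mixed* (w.r.t. terminal sets `A'`, `B'`) if some connected
component of the graph with edge set `M₁ Δ M₂` is a simple path with one endpoint in
`A'` and the other endpoint in `B'`. -/
def Mixed {V : Type} [DecidableEq V] (A' B' : Finset V) (M₁ M₂ : Finset (Sym2 V)) : Prop :=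
  ∃ u v : V, u ∈ A' ∧ v ∈ B' ∧
    ∃ p : (SimpleGraph.fromEdgeSet (↑(symmDiff M₁ M₂) : Set (Sym2 V))).Walk u v,
      p.IsPath ∧
      {e | e ∈ p.edges} =
        compEdges (SimpleGraph.fromEdgeSet (↑(symmDiff M₁ M₂) : Set (Sym2 V))) u

/-- Mixedness of a pair of matchings depends only on their symmetric difference `D`. It yields
terminals `u ∈ A'`, `v ∈ B'` and a vertex set `C` closed under `D`-adjacency that contains them,
in which every other vertex lies on two distinct edges of `D`. -/
def IsMixedComponent {V : Type} (A' B' : Finset V) (D : Finset (Sym2 V))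
    (c : V × V × Set V) : Prop :=
  c.1 ∈ A' ∧ c.2.1 ∈ B' ∧ c.1 ∈ c.2.2 ∧ c.2.1 ∈ c.2.2 ∧
    (∀ e ∈ D, ∀ x ∈ e, ∀ y ∈ e, x ∈ c.2.2 → y ∈ c.2.2) ∧
    ∀ x ∈ c.2.2, x ≠ c.1 → x ≠ c.2.1 → ∃ e₁ ∈ D, ∃ e₂ ∈ D, e₁ ≠ e₂ ∧ x ∈ e₁ ∧ x ∈ e₂

theorem Mixed.exists_isMixedComponent {V : Type} [DecidableEq V] {A' B' : Finset V}
    {M₁ M₂ : Finset (Sym2 V)} (h : Mixed A' B' M₁ M₂) :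
    ∃ c, IsMixedComponent A' B' (symmDiff M₁ M₂) c := by
  unfold Mixed at h
  generalize symmDiff M₁ M₂ = D at h ⊢
  generalize hG : SimpleGraph.fromEdgeSet (↑D : Set (Sym2 V)) = G at h
  obtain ⟨u, v, hu, hv, p, hp, hpe⟩ := h
  refine ⟨(u, v, {x | G.Reachable u x}), hu, hv, SimpleGraph.Reachable.refl u, p.reachable,
    ?_, ?_⟩
  · intro e he x hx y hy hux
    by_cases hxy : x = y
    · exact hxy ▸ hux
    · have he' : e = s(x, y) := (Sym2.mem_and_mem_iff hxy).1 ⟨hx, hy⟩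
      have hadj : G.Adj x y := by
        rw [← hG, SimpleGraph.fromEdgeSet_adj]
        exact ⟨by simpa [← he'] using he, hxy⟩
      exact SimpleGraph.Reachable.trans hux hadj.reachable
  · intro x hux hxu hxv
    simp only [Set.mem_ofPred_eq] at hux hxu hxv
    obtain ⟨q⟩ := hux.symm
    have hsupp : x ∈ p.support := by
      cases q with
      | nil => exact absurd rfl hxu
      | @cons _ y _ hadj q' =>
        have hmem : s(x, y) ∈ compEdges G u :=
          ⟨hadj, x, Sym2.mem_mk_left x y, hux⟩
        rw [← hpe] at hmem
        exact p.fst_mem_support_of_mem_edges hmem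
    obtain ⟨i, hi, hil⟩ := SimpleGraph.Walk.mem_support_iff_exists_getVert.1 hsupp
    have hi0 : i ≠ 0 := by
      rintro rfl
      simp at hi
      exact hxu hi.symm
    have hilt : i < p.length := by
      refine lt_of_le_of_ne hil ?_
      rintro rfl
      simp at hi
      exact hxv hi.symm
    have hcard := hp.ncard_neighborSet_toSubgraph_internal_eq_two hi0 hilt
    rw [hi] at hcard
    obtain ⟨a, b, hab, hset⟩ := Set.ncard_eq_two.1 hcard
    have key : ∀ a ∈ p.toSubgraph.neighborSet x, s(x, a) ∈ D := by
      intro a ha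
      have := p.toSubgraph.adj_sub ha
      rw [← hG, SimpleGraph.fromEdgeSet_adj] at this
      exact this.1
    refine ⟨s(x, a), key a (by simp [hset]), s(x, b), key b (by simp [hset]), ?_,
      Sym2.mem_mk_left _ _, Sym2.mem_mk_left _ _⟩
    rwa [Ne, Sym2.congr_right]

theorem IsPMon.eq_of_mem {V : Type} {H : SimpleGraph V} {S : Set V} {M : Finset (Sym2 V)}
    (h : IsPMon H S M) {x : V} {e f : Sym2 V} (he : e ∈ M) (hf : f ∈ M) (hxe : x ∈ e)
    (hxf : x ∈ f) : e = f :=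
  (h.2 x ((h.1 e he).2 x hxe)).unique ⟨he, hxe⟩ ⟨hf, hxf⟩

/-- Terminals lie on at most one edge of the symmetric difference, so a mixed component contains
no terminals besides its two distinguished ones. -/
theorem IsMixedComponent.eq_or_eq {V : Type} [DecidableEq V] {H : SimpleGraph V}
    {A' B' W X : Finset V} {M₁ M₂ : Finset (Sym2 V)} {c : V × V × Set V}
    (hc : IsMixedComponent A' B' (symmDiff M₁ M₂) c)
    (h₁ : IsPMon H (inducedVerts W X) M₁) (h₂ : IsPMon H (inducedVerts W (W \ X)) M₂)
    {x : V} (hxW : x ∈ W) (hx : x ∈ c.2.2) : x = c.1 ∨ x = c.2.1 := by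
  by_contra! hne
  obtain ⟨e, he, f, hf, hef, hxe, hxf⟩ := hc.2.2.2.2.2 x hx hne.1 hne.2
  have hcase : ∀ e ∈ M₁, ∀ f ∈ M₂, x ∈ e → x ∈ f → False := by
    intro e he f hf hxe hxf
    have a := (h₁.1 e he).2 x hxe
    have b := (h₂.1 f hf).2 x hxf
    simp [inducedVerts, hxW] at a b
    exact b a
  rw [Finset.mem_symmDiff] at he hf
  rcases he with ⟨he, -⟩ | ⟨he, -⟩ <;> rcases hf with ⟨hf, -⟩ | ⟨hf, -⟩
  · exact hef (h₁.eq_of_mem he hf hxe hxf)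
  · exact hcase e he f hf hxe hxf
  · exact hcase f hf e he hxf hxe
  · exact hef (h₂.eq_of_mem he hf hxe hxf)

open Classical in
/-- The edges of `D` that meet the vertex set `C`. -/
noncomputable def edgesMeeting {V : Type} (D : Finset (Sym2 V)) (C : Set V) :
    Finset (Sym2 V) :=
  D.filter fun e => ∃ y ∈ e, y ∈ C

theorem edgesMeeting_subset {V : Type} (D : Finset (Sym2 V)) (C : Set V) :
    edgesMeeting D C ⊆ D :=
  by classical exact Finset.filter_subset _ _

/-- Exchanging two matchings along the edges meeting a union `C` of components of their symmetric
difference gives a perfect matching of the vertex set exchanged on `C`. -/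
theorem IsPMon.symmDiff_edgesMeeting {V : Type} [DecidableEq V] {H : SimpleGraph V}
    {S₁ S₂ S : Set V} {M₁ M₂ D : Finset (Sym2 V)} {C : Set V}
    (h₁ : IsPMon H S₁ M₁) (h₂ : IsPMon H S₂ M₂) (hD : D = symmDiff M₁ M₂)
    (hC : ∀ e ∈ D, ∀ x ∈ e, ∀ y ∈ e, x ∈ C → y ∈ C)
    (hin : ∀ x ∈ C, (x ∈ S ↔ x ∈ S₂)) (hout : ∀ x ∉ C, (x ∈ S ↔ x ∈ S₁)) :
    IsPMon H S (symmDiff M₁ (edgesMeeting D C)) := by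
  have mem_in : ∀ x ∈ C, ∀ e, x ∈ e →
      (e ∈ symmDiff M₁ (edgesMeeting D C) ↔ e ∈ M₂) := by
    intro x hx e hxe
    have : ∃ y ∈ e, y ∈ C := ⟨x, hxe, hx⟩
    simp only [edgesMeeting, hD, Finset.mem_symmDiff, Finset.mem_filter, this]
    tauto
  have mem_out : ∀ x ∉ C, ∀ e, x ∈ e →
      (e ∈ symmDiff M₁ (edgesMeeting D C) ↔ e ∈ M₁) := by
    intro x hx e hxe
    have : e ∉ edgesMeeting D C := by
      simp only [edgesMeeting, Finset.mem_filter, not_and]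
      rintro he ⟨y, hy, hyC⟩
      exact hx (hC e he y hy x hxe hyC)
    simp only [Finset.mem_symmDiff, this]
    tauto
  refine ⟨fun e he => ⟨?_, fun x hx => ?_⟩, fun x hx => ?_⟩
  · have : e ∈ M₁ ∨ e ∈ M₂ := by
      simp only [edgesMeeting, hD, Finset.mem_symmDiff, Finset.mem_filter] at he
      tauto
    exact this.elim (fun h => (h₁.1 e h).1) fun h => (h₂.1 e h).1
  · by_cases hxC : x ∈ C
    · exact (hin x hxC).2 ((h₂.1 e ((mem_in x hxC e hx).1 he)).2 x hx)
    · exact (hout x hxC).2 ((h₁.1 e ((mem_out x hxC e hx).1 he)).2 x hx)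
  · by_cases hxC : x ∈ C
    · refine (existsUnique_congr fun e => ?_).2 (h₂.2 x ((hin x hxC).1 hx))
      exact and_congr_left (mem_in x hxC e)
    · refine (existsUnique_congr fun e => ?_).2 (h₁.2 x ((hout x hxC).1 hx))
      exact and_congr_left (mem_out x hxC e)

theorem prod_symmDiff_mul_prod_symmDiff {α R : Type*} [Fintype α] [DecidableEq α]
    [CommMonoid R] (w : α → R) {s t p : Finset α} (hp : p ⊆ symmDiff s t) :
    (∏ e ∈ symmDiff s p, w e) * ∏ e ∈ symmDiff t p, w e = (∏ e ∈ s, w e) * ∏ e ∈ t, w e := by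
  have h : ∀ q : Finset α, ∏ e ∈ q, w e = ∏ e, if e ∈ q then w e else 1 := fun q => by
    simp
  simp only [h, ← Finset.prod_mul_distrib]
  refine Finset.prod_congr rfl fun e _ => ?_
  have hpe := @hp e
  by_cases h₁ : e ∈ s <;> by_cases h₂ : e ∈ t <;> by_cases h₃ : e ∈ p <;>
    simp_all [Finset.mem_symmDiff]

theorem neg_one_pow_card_symmDiff_pair {V R : Type*} [DecidableEq V] [Ring R]
    {A X : Finset V} {u v : V} (hu : u ∈ A) (hv : v ∉ A) :
    (-1 : R) ^ (symmDiff X {u, v} ∩ A).card = -(-1) ^ (X ∩ A).card := by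
  by_cases huX : u ∈ X
  · have h : X ∩ A = insert u (symmDiff X {u, v} ∩ A) := by
      ext x
      simp only [Finset.mem_inter, Finset.mem_insert, Finset.mem_symmDiff,
        Finset.mem_singleton]
      grind
    rw [h, Finset.card_insert_of_notMem (by simp [Finset.mem_symmDiff, huX]), pow_succ]
    simp
  · have h : symmDiff X {u, v} ∩ A = insert u (X ∩ A) := by
      ext x
      simp only [Finset.mem_inter, Finset.mem_insert, Finset.mem_symmDiff,
        Finset.mem_singleton]
      grind
    rw [h, Finset.card_insert_of_notMem (by simp [huX]), pow_succ]
    simp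

/-- A mixed component of `D` if there is one. -/
noncomputable def mixedComponent {V : Type} [Nonempty V] (A' B' : Finset V)
    (D : Finset (Sym2 V)) : V × V × Set V :=
  (Classical.epsilon (IsMixedComponent A' B' D) : V × V × Set V)

/-- Exchange of the two matchings of a triple along the chosen component. -/
noncomputable def swapTriple {V : Type} [DecidableEq V] [Nonempty V] (A' B' : Finset V)
    (t : Finset V × Finset (Sym2 V) × Finset (Sym2 V)) :
    Finset V × Finset (Sym2 V) × Finset (Sym2 V) :=
  let D := symmDiff t.2.1 t.2.2
  let c := mixedComponent A' B' D
  (symmDiff t.1 {c.1, c.2.1}, symmDiff t.2.1 (edgesMeeting D c.2.2),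
    symmDiff t.2.2 (edgesMeeting D c.2.2))

/-- Mixed triples of vertex set and pair of matchings. -/
def IsMixedTriple {V : Type} [DecidableEq V] (H : SimpleGraph V) (A' B' W : Finset V)
    (t : Finset V × Finset (Sym2 V) × Finset (Sym2 V)) : Prop :=
  t.1 ⊆ W ∧ IsPMon H (inducedVerts W t.1) t.2.1 ∧
    IsPMon H (inducedVerts W (W \ t.1)) t.2.2 ∧ Mixed A' B' t.2.1 t.2.2

section

variable {V : Type} [DecidableEq V] [Nonempty V] {A' B' : Finset V}
  {t : Finset V × Finset (Sym2 V) × Finset (Sym2 V)}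

theorem symmDiff_swapTriple : symmDiff (swapTriple A' B' t).2.1 (swapTriple A' B' t).2.2 =
    symmDiff t.2.1 t.2.2 := by
  simp only [swapTriple]
  rw [symmDiff_symmDiff_symmDiff_comm, symmDiff_self, symmDiff_bot]

theorem swapTriple_swapTriple : swapTriple A' B' (swapTriple A' B' t) = t := by
  have h := symmDiff_swapTriple (A' := A') (B' := B') (t := t)
  rw [swapTriple, h]
  simp only [swapTriple, symmDiff_symmDiff_cancel_right]

theorem isMixedComponent_mixedComponent {M₁ M₂ : Finset (Sym2 V)} (h : Mixed A' B' M₁ M₂) :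
    IsMixedComponent A' B' (symmDiff M₁ M₂) (mixedComponent A' B' (symmDiff M₁ M₂)) :=
  Classical.epsilon_spec h.exists_isMixedComponent

theorem IsMixedTriple.swapTriple {H : SimpleGraph V}
    (h : IsMixedTriple H A' B' (A' ∪ B') t) :
    IsMixedTriple H A' B' (A' ∪ B') (swapTriple A' B' t) := by
  obtain ⟨X, M₁, M₂⟩ := t
  obtain ⟨hX, h₁, h₂, hm⟩ := h
  have hc := isMixedComponent_mixedComponent hm
  have hsymm := symmDiff_swapTriple (A' := A') (B' := B') (t := (X, M₁, M₂))
  have hW : ∀ x ∈ A' ∪ B', x ∈ (mixedComponent A' B' (symmDiff M₁ M₂)).2.2 → _ :=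
    fun x hx hxC => hc.eq_or_eq h₁ h₂ hx hxC
  refine ⟨?_, ?_, ?_, ?_⟩
  · simp only [_root_.swapTriple]
    obtain ⟨hu, hv, -⟩ := hc
    intro x hx
    simp only [Finset.mem_symmDiff, Finset.mem_insert, Finset.mem_singleton] at hx
    simp only at hX
    grind
  · obtain ⟨hu, hv, huC, hvC, hclosed, -⟩ := hc
    refine h₁.symmDiff_edgesMeeting h₂ rfl hclosed ?_ ?_ <;> intro x hx <;>
      simp only [inducedVerts, _root_.swapTriple, Set.mem_union, Set.mem_compl_iff,
        Finset.mem_coe, Finset.mem_symmDiff, Finset.mem_sdiff, Finset.mem_insert,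
        Finset.mem_singleton] <;> grind
  · obtain ⟨hu, hv, huC, hvC, hclosed, -⟩ := hc
    refine h₂.symmDiff_edgesMeeting h₁ (symmDiff_comm _ _) hclosed ?_ ?_ <;> intro x hx <;>
      simp only [inducedVerts, _root_.swapTriple, Set.mem_union, Set.mem_compl_iff,
        Finset.mem_coe, Finset.mem_symmDiff, Finset.mem_sdiff, Finset.mem_insert,
        Finset.mem_singleton] <;> grind
  · unfold Mixed at hm ⊢
    rwa [hsymm]

end

open Classical in
theorem stmt1 {V : Type} [Fintype V] [DecidableEq V] {R : Type} [CommRing R]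
    (H : SimpleGraph V) (A' B' W : Finset V)
    (hW : W = A' ∪ B') (hdisj : Disjoint A' B') (w : Sym2 V → R) :
    (∑ X ∈ W.powerset,
      ∑ M₁ ∈ Finset.univ.filter (fun M : Finset (Sym2 V) =>
          IsPMon H (inducedVerts W X) M),
        ∑ M₂ ∈ Finset.univ.filter (fun M : Finset (Sym2 V) =>
            IsPMon H (inducedVerts W (W \ X)) M),
          if Mixed A' B' M₁ M₂ then
            (-1 : R) ^ (X ∩ A').card * ((∏ e ∈ M₁, w e) * ∏ e ∈ M₂, w e)
          else 0) = 0 := by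
  subst hW
  rcases isEmpty_or_nonempty V with hV | hV
  · have hm : ∀ M₁ M₂, ¬ Mixed A' B' M₁ M₂ := fun _ _ ⟨u, _⟩ => hV.elim u
    simp [hm]
  have hsum : ∑ t ∈ Finset.univ.filter (IsMixedTriple H A' B' (A' ∪ B')),
      (-1 : R) ^ (t.1 ∩ A').card * ((∏ e ∈ t.2.1, w e) * ∏ e ∈ t.2.2, w e) = 0 := by
    refine Finset.sum_involution (fun t _ => swapTriple A' B' t) ?_ ?_ ?_ ?_
    · intro t ht
      have hc := isMixedComponent_mixedComponent (Finset.mem_filter.1 ht).2.2.2.2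
      have hv := Finset.disjoint_right.1 hdisj hc.2.1
      simp only [swapTriple]
      rw [neg_one_pow_card_symmDiff_pair hc.1 hv,
        prod_symmDiff_mul_prod_symmDiff w (edgesMeeting_subset _ _)]
      ring
    · intro t _ _ heq
      have h := congrArg Prod.fst heq
      simp only [swapTriple, symmDiff_eq_left] at h
      exact Finset.insert_ne_empty _ _ h
    · intro t ht
      exact Finset.mem_filter.2 ⟨Finset.mem_univ _, (Finset.mem_filter.1 ht).2.swapTriple⟩
    · intro t _
      exact swapTriple_swapTriple
  refine Eq.trans ?_ hsum
  rw [Finset.sum_filter, Fintype.sum_prod_type, ← Finset.sum_subset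
    (Finset.subset_univ (A' ∪ B').powerset)]
  · refine Finset.sum_congr rfl fun X hX => ?_
    rw [Fintype.sum_prod_type, Finset.sum_filter]
    refine Finset.sum_congr rfl fun M₁ _ => ?_
    rw [Finset.sum_filter]
    by_cases h₁ : IsPMon H (inducedVerts (A' ∪ B') X) M₁
    · rw [if_pos h₁]
      refine Finset.sum_congr rfl fun M₂ _ => ?_
      simp only [IsMixedTriple, Finset.mem_powerset.1 hX, h₁, true_and, ite_and]
    · simp [IsMixedTriple, h₁]
  · intro X _ hX
    simp only [Finset.mem_powerset] at hX
    simp [IsMixedTriple, hX]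
end

section
/- Suppose a solution to Disjoint A,B-paths on G exists. Then in the polynomial p(G,s) ∈ ℤ[s], the coefficient of s^k is zero for every k > 2Λ − ℓ_{A,B}, and the coefficient of s^{2Λ−ℓ_{A,B}} equals 2^{|Z|/2} · S_{A,B}. In particular, if c·s^d is the monomial of largest degree in p(G,s) having a positive coefficient, then ℓ_{A,B} = 2Λ − d and S_{A,B} = c / 2^{|Z|/2}. -/
/-- `f` is a family of `(|A|+|B|)/2` pairwise vertex-disjoint simple paths of `G`,
each with both endpoints in `A` or both endpoints in `B`, such that every vertex of
`A ∪ B` is an endpoint of one of the paths, and `E'` is the union of their edge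
sets.  This witnesses that `E'` is a solution to Disjoint `A`,`B`-paths. -/
def IsPathFamily {V : Type} [DecidableEq V] (G : SimpleGraph V) (A B : Finset V)
    (E' : Set (Sym2 V)) {k : ℕ} (f : Fin k → (u : V) × (v : V) × G.Walk u v) : Prop :=
  k = (A.card + B.card) / 2 ∧
  (∀ i, (f i).2.2.IsPath) ∧
  (∀ i, ((f i).1 ∈ A ∧ (f i).2.1 ∈ A) ∨ ((f i).1 ∈ B ∧ (f i).2.1 ∈ B)) ∧
  (∀ i j, i ≠ j → ∀ x, x ∈ (f i).2.2.support → x ∉ (f j).2.2.support) ∧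
  (∀ z, z ∈ A ∪ B → ∃ i, z = (f i).1 ∨ z = (f i).2.1) ∧
  E' = ⋃ i, {e | e ∈ (f i).2.2.edges}

/-- `E'` is a solution to Disjoint `A`,`B`-paths on `G`. -/
def IsSolution {V : Type} [DecidableEq V] (G : SimpleGraph V) (A B : Finset V)
    (E' : Set (Sym2 V)) : Prop :=
  ∃ (k : ℕ) (f : Fin k → (u : V) × (v : V) × G.Walk u v), IsPathFamily G A B E' f

/-- The length of an edge set: the sum of the lengths of its edges. -/
noncomputable def lengthOf {V : Type} (ℓ : Sym2 V → ℕ) (E' : Set (Sym2 V)) : ℕ :=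
  ∑ᶠ e ∈ E', ℓ e

/-- `ℓ_{A,B}`: the minimum length of a solution to Disjoint `A`,`B`-paths. -/
noncomputable def lAB {V : Type} [DecidableEq V] (G : SimpleGraph V) (A B : Finset V)
    (ℓ : Sym2 V → ℕ) : ℕ :=
  sInf {n | ∃ E', IsSolution G A B E' ∧ lengthOf ℓ E' = n}

/-- `S_{A,B}`: the number of minimum-length solutions to Disjoint `A`,`B`-paths. -/
noncomputable def nSol {V : Type} [DecidableEq V] (G : SimpleGraph V) (A B : Finset V)
    (ℓ : Sym2 V → ℕ) : ℕ :=
  Set.ncard {E' | IsSolution G A B E' ∧ lengthOf ℓ E' = lAB G A B ℓ}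


/-- The vertex type of the gadget graph `H`: `Sum.inl (v, i)` is the gadget vertex
`hᵢ(v)` and `Sum.inr z` is the terminal center `h(z)` (used only for `z ∈ Z`). -/
abbrev HVert (V : Type) : Type := (V × Fin 3) ⊕ V

/-- Base relation for the gadget graph `H`: triangle edges inside nonterminal
gadgets, star edges inside terminal gadgets, and external edges between gadgets
(one external edge `h_{idx u (uv)}(u) h_{idx v (uv)}(v)` for every edge `uv` of `G`). -/
def hRel {V : Type} (G : SimpleGraph V) (idx : V → Sym2 V → Fin 3) (Z : Finset V) :
    HVert V → HVert V → Prop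
  | .inl (u, i), .inl (w, j) =>
      (u = w ∧ u ∉ Z ∧ i ≠ j) ∨
      (G.Adj u w ∧ idx u s(u, w) = i ∧ idx w s(u, w) = j)
  | .inr z, .inl (w, _) => z ∈ Z ∧ z = w
  | _, _ => False

/-- The gadget graph `H` (with terminal set `Z`). -/
def gadgetGraph {V : Type} (G : SimpleGraph V) (idx : V → Sym2 V → Fin 3)
    (Z : Finset V) : SimpleGraph (HVert V) :=
  SimpleGraph.fromRel (hRel G idx Z)

/-- The vertex set of `H(X)`: all gadget vertices, and the centers `h(z)` for `z ∈ X`. -/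
def gadgetVerts {V : Type} (X : Finset V) : Set (HVert V) :=
  fun x => match x with
  | .inl _ => True
  | .inr z => z ∈ X

/-- `M` is (the edge set of) a perfect matching of `H(X)`. -/
def IsPMgadget {V : Type} (G : SimpleGraph V) (idx : V → Sym2 V → Fin 3)
    (Z X : Finset V) (M : Finset (Sym2 (HVert V))) : Prop :=
  (∀ e ∈ M, e ∈ (gadgetGraph G idx Z).edgeSet ∧ ∀ x ∈ e, x ∈ gadgetVerts X) ∧
  (∀ x ∈ gadgetVerts X, ∃! e, e ∈ M ∧ x ∈ e)

/-- The endpoint, in the gadget of `u`, of the external edge of `H` representing the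
edge `uv'` of `G`; this is `f(uv') = h_{idx u (uv')}(u)`. -/
def fEnd {V : Type} (idx : V → Sym2 V → Fin 3) (u v' : V) : HVert V :=
  Sum.inl (u, idx u s(u, v'))

/-- The external edge of `H` representing an edge of `G`. -/
def extEdge {V : Type} (idx : V → Sym2 V → Fin 3) : Sym2 V → Sym2 (HVert V) :=
  Sym2.lift ⟨fun u v => s(fEnd idx u v, fEnd idx v u), by
    intro u v
    exact Sym2.eq_swap⟩

open Classical in
/-- The weight of an edge of `H`: `s ^ ℓ(e)` for the external edge representing the
edge `e` of `G`, and `1` for internal edges (as a polynomial in `ℤ[s]`). -/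
noncomputable def wt {V : Type} (G : SimpleGraph V) (ℓ : Sym2 V → ℕ)
    (idx : V → Sym2 V → Fin 3) (ε : Sym2 (HVert V)) : Polynomial ℤ :=
  if h : ∃ e, e ∈ G.edgeSet ∧ ε = extEdge idx e then Polynomial.X ^ ℓ h.choose else 1

open Classical in
/-- `pm(H(X))`: the sum of the weights of all perfect matchings of `H(X)`. -/
noncomputable def pmPoly {V : Type} [Fintype V] [DecidableEq V] (G : SimpleGraph V)
    (ℓ : Sym2 V → ℕ) (idx : V → Sym2 V → Fin 3) (Z X : Finset V) : Polynomial ℤ :=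
  ∑ M ∈ Finset.univ.filter (fun M : Finset (Sym2 (HVert V)) => IsPMgadget G idx Z X M),
    ∏ e ∈ M, wt G ℓ idx e

open Classical in
/-- The polynomial `p(G,s) = Σ_{X ⊆ Z} (−1)^{|X∩A|} pm(H(X)) pm(H(Z∖X))`. -/
noncomputable def pPoly {V : Type} [Fintype V] [DecidableEq V] (G : SimpleGraph V)
    (A B : Finset V) (ℓ : Sym2 V → ℕ) (idx : V → Sym2 V → Fin 3) : Polynomial ℤ :=
  ∑ X ∈ (A ∪ B).powerset,
    (-1 : Polynomial ℤ) ^ (X ∩ A).card *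
      (pmPoly G ℓ idx (A ∪ B) X * pmPoly G ℓ idx (A ∪ B) ((A ∪ B) \ X))

/-- `Λ`: the total length of all edges of `G`. -/
noncomputable def totalLen {V : Type} (G : SimpleGraph V) (ℓ : Sym2 V → ℕ) : ℕ :=
  ∑ᶠ e ∈ G.edgeSet, ℓ e

section EdgeSets

variable {V : Type} [DecidableEq V]

/-- The degree of the vertex `v` in the edge set `C`. -/
def edgeDeg (C : Finset (Sym2 V)) (v : V) : ℕ := (C.filter (v ∈ ·)).card

lemma edgeDeg_mono {C D : Finset (Sym2 V)} (h : C ⊆ D) (v : V) : edgeDeg C v ≤ edgeDeg D v :=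
  Finset.card_le_card (Finset.filter_subset_filter _ h)

lemma edgeDeg_congr {C D : Finset (Sym2 V)} {v : V} (h : ∀ e, v ∈ e → (e ∈ C ↔ e ∈ D)) :
    edgeDeg C v = edgeDeg D v := by
  unfold edgeDeg
  congr 1
  ext e
  simp only [Finset.mem_filter]
  constructor <;> rintro ⟨h1, h2⟩
  · exact ⟨(h e h2).1 h1, h2⟩
  · exact ⟨(h e h2).2 h1, h2⟩

lemma edgeDeg_symmDiff (C D : Finset (Sym2 V)) (v : V) :
    edgeDeg (symmDiff C D) v + 2 * edgeDeg (C ∩ D) v = edgeDeg C v + edgeDeg D v := by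
  unfold edgeDeg
  rw [show (symmDiff C D).filter (v ∈ ·) =
      (C.filter (v ∈ ·) \ D.filter (v ∈ ·)) ∪ (D.filter (v ∈ ·) \ C.filter (v ∈ ·)) by
    ext e; simp only [Finset.mem_filter, Finset.mem_symmDiff, Finset.mem_union,
      Finset.mem_sdiff]; tauto,
    Finset.card_union_of_disjoint (Finset.disjoint_left.2 fun e h1 h2 =>
      (Finset.mem_sdiff.1 h2).2 (Finset.mem_sdiff.1 h1).1),
    Finset.filter_inter_distrib]
  have h1 := Finset.card_sdiff_add_card_inter (C.filter (v ∈ ·)) (D.filter (v ∈ ·))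
  have h2 := Finset.card_sdiff_add_card_inter (D.filter (v ∈ ·)) (C.filter (v ∈ ·))
  rw [Finset.inter_comm] at h2
  omega

lemma edgeDeg_edges_of_isPath {G : SimpleGraph V} {u v : V} (p : G.Walk u v) (hp : p.IsPath)
    (x : V) :
    edgeDeg p.edges.toFinset x + (if x = u then 1 else 0) + (if x = v then 1 else 0) =
      if x ∈ p.support then 2 else 0 := by
  induction p with
  | @nil u => by_cases h : x = u <;> simp [edgeDeg, h]
  | @cons u w v h q ih =>
    rw [SimpleGraph.Walk.cons_isPath_iff] at hp
    have ih := ih hp.1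
    have huw : u ≠ w := h.ne
    have hnot : s(u, w) ∉ q.edges := fun hm => hp.2 (q.fst_mem_support_of_mem_edges hm)
    have hdeg : edgeDeg (SimpleGraph.Walk.cons h q).edges.toFinset x =
        edgeDeg q.edges.toFinset x + (if x = u then 1 else 0) + (if x = w then 1 else 0) := by
      unfold edgeDeg
      rw [SimpleGraph.Walk.edges_cons, List.toFinset_cons, Finset.filter_insert]
      by_cases hx : x ∈ s(u, w)
      · rw [if_pos hx, Finset.card_insert_of_notMem (by simp [hnot])]
        rcases Sym2.mem_iff.1 hx with rfl | rfl
        · simp [huw]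
        · simp [huw.symm]
      · rw [if_neg hx]
        simp only [Sym2.mem_iff, not_or] at hx
        simp [hx]
    rw [hdeg, SimpleGraph.Walk.support_cons]
    by_cases hxu : x = u
    · subst hxu
      rw [if_neg hp.2] at ih
      simp only [List.mem_cons, true_or, if_true]
      omega
    · simp [hxu] at ih ⊢
      omega

/-- The vertex set `W` is a union of components of the edge set `D`. -/
def IsClosedUnder (D : Finset (Sym2 V)) (W : Finset V) : Prop :=
  ∀ e ∈ D, ∀ x ∈ e, ∀ y ∈ e, x ∈ W → y ∈ W

/-- Every union of components of `D` contains an even number of vertices of `A`. -/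
def IsBalanced (A : Finset V) (D : Finset (Sym2 V)) : Prop :=
  ∀ W, IsClosedUnder D W → Even (A ∩ W).card

/-- Within a union of components of `D`, the number of vertices of odd degree is even. -/
lemma IsClosedUnder.even_card_odd [Fintype V] {D : Finset (Sym2 V)} {W : Finset V}
    (hD : ∀ e ∈ D, ¬ e.IsDiag) (hW : IsClosedUnder D W) :
    Even (W.filter fun v => Odd (edgeDeg D v)).card := by
  rw [← Finset.even_sum_iff_even_card_odd]
  have h1 : ∑ v ∈ W, edgeDeg D v = ∑ e ∈ D, (W.filter (· ∈ e)).card := by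
    unfold edgeDeg
    exact Finset.sum_card_bipartiteAbove_eq_sum_card_bipartiteBelow (fun v e => v ∈ e)
  rw [h1]
  refine Finset.even_sum _ fun e he => ?_
  induction e with
  | _ x y =>
    have hxy : x ≠ y := by simpa using hD _ he
    by_cases hx : x ∈ W
    · have hy : y ∈ W := hW _ he x (by simp) y (by simp) hx
      rw [show W.filter (· ∈ s(x, y)) = {x, y} by
        ext z; simp only [Finset.mem_filter, Sym2.mem_iff, Finset.mem_insert,
          Finset.mem_singleton]; grind, Finset.card_pair hxy]
      exact even_two
    · have hy : y ∉ W := fun hy => hx (hW _ he y (by simp) x (by simp) hy)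
      rw [show W.filter (· ∈ s(x, y)) = ∅ by
        ext z; simp only [Finset.mem_filter, Sym2.mem_iff, Finset.notMem_empty]; grind]
      simp

lemma mem_edges_of_edgeDeg_le {G : SimpleGraph V} {D : Finset (Sym2 V)} {u v : V}
    (p : G.Walk u v) (hp : p.IsPath) (huv : u ≠ v) (hpD : ∀ e ∈ p.edges, e ∈ D)
    (hu : edgeDeg D u ≤ 1) (hv : edgeDeg D v ≤ 1) (hD : ∀ x, edgeDeg D x ≤ 2)
    {x : V} (hx : x ∈ p.support) {e : Sym2 V} (he : e ∈ D) (hxe : x ∈ e) : e ∈ p.edges := by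
  have hsub : p.edges.toFinset ⊆ D := fun e he => hpD e (List.mem_toFinset.1 he)
  have hle : edgeDeg D x ≤ edgeDeg p.edges.toFinset x := by
    have h := edgeDeg_edges_of_isPath p hp x
    have h2 := hD x
    rw [if_pos hx] at h
    grind
  have heq := Finset.eq_of_subset_of_card_le
    (Finset.filter_subset_filter (fun e => x ∈ e) hsub) hle
  have : e ∈ D.filter (x ∈ ·) := Finset.mem_filter.2 ⟨he, hxe⟩
  rw [← heq] at this
  simpa using (Finset.mem_filter.1 this).1

/-- A link of `D` between terminals: a path of `D` joining two distinct vertices of `Z` whose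
support is the whole component. -/
lemma eq_endpoint_of_mem_support {G : SimpleGraph V} {D : Finset (Sym2 V)} {u v : V}
    (p : G.Walk u v) (hp : p.IsPath) (hpD : ∀ e ∈ p.edges, e ∈ D)
    {x : V} (hx : x ∈ p.support) (hx1 : edgeDeg D x ≤ 1) : x = u ∨ x = v := by
  have hsub : p.edges.toFinset ⊆ D := fun e he => hpD e (List.mem_toFinset.1 he)
  have h := edgeDeg_edges_of_isPath p hp x
  have h2 := edgeDeg_mono hsub x
  rw [if_pos hx] at h
  grind

end EdgeSets

section Solutions

variable {V : Type} [Fintype V] [DecidableEq V]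

open Classical in
/-- A terminal of a balanced edge set `D` has a partner of the same kind in its component. -/
lemma exists_partner {A B : Finset V} {D : Finset (Sym2 V)} (hdisj : Disjoint A B)
    (hdiag : ∀ e ∈ D, ¬ e.IsDiag) (hZ : ∀ z ∈ A ∪ B, edgeDeg D z = 1)
    (heven : ∀ v, v ∉ A ∪ B → Even (edgeDeg D v)) (hbal : IsBalanced A D)
    {W : Finset V} (hW : IsClosedUnder D W) {z : V} (hz : z ∈ A ∪ B) (hzW : z ∈ W) :
    ∃ z' ∈ W, z ≠ z' ∧ ((z ∈ A ∧ z' ∈ A) ∨ (z ∈ B ∧ z' ∈ B)) := by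
  have hA := hbal W hW
  have hodd : (W.filter fun v => Odd (edgeDeg D v)) = (A ∩ W) ∪ (B ∩ W) := by
    ext v
    simp only [Finset.mem_filter, Finset.mem_union, Finset.mem_inter]
    by_cases hv : v ∈ A ∪ B
    · have : Odd (edgeDeg D v) := by rw [hZ v hv]; exact odd_one
      rw [Finset.mem_union] at hv
      tauto
    · have := heven v hv
      rw [← Nat.not_odd_iff_even] at this
      rw [Finset.mem_union] at hv
      tauto
  have hB : Even (B ∩ W).card := by
    have h := hW.even_card_odd hdiag
    rw [hodd, Finset.card_union_of_disjoint
      (hdisj.mono Finset.inter_subset_left Finset.inter_subset_left)] at h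
    exact (Nat.even_add.1 h).1 hA
  have key : ∀ C : Finset V, Even (C ∩ W).card → z ∈ C → ∃ z' ∈ W, z ≠ z' ∧ z' ∈ C := by
    intro C hC hzC
    have hmem : z ∈ C ∩ W := Finset.mem_inter.2 ⟨hzC, hzW⟩
    have hne : (C ∩ W).card ≠ 1 := fun h => by simp [h] at hC
    have hpos := Finset.card_pos.2 ⟨z, hmem⟩
    obtain ⟨z', hz', hne'⟩ := Finset.exists_mem_ne (show 1 < (C ∩ W).card by omega) z
    exact ⟨z', (Finset.mem_inter.1 hz').2, hne'.symm, (Finset.mem_inter.1 hz').1⟩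
  rcases Finset.mem_union.1 hz with h | h
  · obtain ⟨z', h1, h2, h3⟩ := key A hA h
    exact ⟨z', h1, h2, Or.inl ⟨h, h3⟩⟩
  · obtain ⟨z', h1, h2, h3⟩ := key B hB h
    exact ⟨z', h1, h2, Or.inr ⟨h, h3⟩⟩

open Classical in
/-- A balanced edge set with the degrees of a path system contains a solution. -/
theorem exists_isSolution_subset {G : SimpleGraph V} {A B : Finset V} {D : Finset (Sym2 V)}
    (hDG : ∀ e ∈ D, e ∈ G.edgeSet) (hdisj : Disjoint A B)
    (hZ : ∀ z ∈ A ∪ B, edgeDeg D z = 1) (heven : ∀ v, v ∉ A ∪ B → Even (edgeDeg D v))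
    (hle : ∀ v, edgeDeg D v ≤ 2) (hbal : IsBalanced A D) :
    ∃ E' : Finset (Sym2 V), E' ⊆ D ∧ IsSolution G A B (E' : Set (Sym2 V)) := by
  set H := SimpleGraph.fromEdgeSet (D : Set (Sym2 V)) with hH
  have hdiag : ∀ e ∈ D, ¬ e.IsDiag := fun e he => G.not_isDiag_of_mem_edgeSet (hDG e he)
  have hadj : ∀ e ∈ H.edgeSet, e ∈ D := by
    intro e he
    rw [hH, SimpleGraph.edgeSet_fromEdgeSet] at he
    exact he.1
  have hHG : H ≤ G := by
    intro x y h
    exact hDG _ (hadj s(x, y) h)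
  have hwalk : ∀ {u v : V} (p : H.Walk u v), ∀ e ∈ p.edges, e ∈ D :=
    fun p e he => hadj e (p.edges_subset_edgeSet he)
  have hclosed : ∀ K : H.ConnectedComponent,
      IsClosedUnder D (Finset.univ.filter fun v => H.connectedComponentMk v = K) := by
    intro K e he x hx y hy hxK
    simp only [Finset.mem_filter, Finset.mem_univ, true_and] at hxK ⊢
    by_cases hxy : x = y
    · rwa [← hxy]
    · have : H.Adj x y := by
        rw [hH, SimpleGraph.fromEdgeSet_adj]
        refine ⟨?_, hxy⟩
        rwa [← (Sym2.mem_and_mem_iff hxy).1 ⟨hx, hy⟩]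
      rw [← hxK]
      exact (SimpleGraph.ConnectedComponent.sound this.reachable).symm
  set 𝒦 := (A ∪ B).image H.connectedComponentMk with h𝒦
  have key : ∀ K : 𝒦, ∃ (u v : V) (p : H.Walk u v), p.IsPath ∧ u ≠ v ∧
      ((u ∈ A ∧ v ∈ A) ∨ (u ∈ B ∧ v ∈ B)) ∧ H.connectedComponentMk u = K ∧
      (A ∪ B).filter (fun z => H.connectedComponentMk z = K) = {u, v} := by
    rintro ⟨K, hK⟩
    obtain ⟨z, hz, rfl⟩ := Finset.mem_image.1 hK
    obtain ⟨z', hz'W, hne, htype⟩ := exists_partner hdisj hdiag hZ heven hbal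
      (hclosed (H.connectedComponentMk z)) hz (by simp)
    have hz' : z' ∈ A ∪ B := by
      rw [Finset.mem_union]
      tauto
    simp only [Finset.mem_filter, Finset.mem_univ, true_and] at hz'W
    obtain ⟨p, hp⟩ := (SimpleGraph.ConnectedComponent.exact hz'W.symm).exists_isPath
    refine ⟨z, z', p, hp, hne, htype, rfl, ?_⟩
    have hsupp : ∀ x, H.Reachable z x → x ∈ p.support := by
      intro x hx
      obtain ⟨q⟩ := hx
      have : ∀ {a b : V} (q : H.Walk a b), a ∈ p.support → b ∈ p.support := by
        intro a b q
        induction q with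
        | nil => exact id
        | @cons a c b h q ih =>
          intro ha
          apply ih
          have he := mem_edges_of_edgeDeg_le p hp hne (hwalk p) (hZ z hz).le (hZ z' hz').le hle ha
            (hadj s(a, c) h) (by simp)
          exact p.snd_mem_support_of_mem_edges he
      exact this q p.start_mem_support
    ext x
    simp only [Finset.mem_filter, Finset.mem_insert, Finset.mem_singleton]
    constructor
    · rintro ⟨hx, hxz⟩
      exact eq_endpoint_of_mem_support p hp (hwalk p)
        (hsupp x (SimpleGraph.ConnectedComponent.exact hxz.symm)) (hZ x hx).le
    · rintro (rfl | rfl)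
      · exact ⟨hz, rfl⟩
      · exact ⟨hz', hz'W⟩
  choose u v p hp hne htype hu hfilter using key
  have hcard : (A ∪ B).card = 𝒦.card * 2 := by
    rw [Finset.card_eq_sum_card_fiberwise (f := H.connectedComponentMk) (t := 𝒦)
      (fun x hx => Finset.mem_image_of_mem _ hx)]
    rw [Finset.sum_const_nat]
    intro K hK
    rw [hfilter ⟨K, hK⟩, Finset.card_pair (hne _)]
  let ε := 𝒦.equivFin
  let f : Fin 𝒦.card → (u : V) × (v : V) × G.Walk u v :=
    fun i => ⟨u (ε.symm i), v (ε.symm i), (p (ε.symm i)).mapLe hHG⟩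
  refine ⟨Finset.univ.biUnion fun i => (f i).2.2.edges.toFinset, ?_, 𝒦.card, f, ?_, ?_, ?_, ?_,
    ?_, ?_⟩
  · intro e he
    simp only [Finset.mem_biUnion, Finset.mem_univ, true_and, List.mem_toFinset, f,
      SimpleGraph.Walk.edges_mapLe_eq_edges] at he
    obtain ⟨i, hi⟩ := he
    exact hwalk _ e hi
  · rw [← Finset.card_union_of_disjoint hdisj, hcard]
    simp
  · intro i
    exact (SimpleGraph.Walk.isPath_mapLe hHG).2 (hp _)
  · intro i
    exact htype _
  · intro i j hij x hxi hxj
    simp only [f, SimpleGraph.Walk.support_mapLe_eq_support] at hxi hxj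
    have hmk : ∀ K, x ∈ (p K).support → H.connectedComponentMk x = K := by
      intro K hx
      rw [← hu K]
      exact SimpleGraph.ConnectedComponent.sound ((p K).takeUntil x hx).reachable.symm
    have := (hmk _ hxi).symm.trans (hmk _ hxj)
    exact hij (ε.symm.injective (Subtype.ext this))
  · intro z hz
    have hK : H.connectedComponentMk z ∈ 𝒦 := Finset.mem_image_of_mem _ hz
    refine ⟨ε ⟨_, hK⟩, ?_⟩
    simp only [f, Equiv.symm_apply_apply]
    have : z ∈ (A ∪ B).filter (fun y => H.connectedComponentMk y = H.connectedComponentMk z) := by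
      simpa using hz
    rw [hfilter ⟨_, hK⟩] at this
    simpa using this
  · ext e
    simp

end Solutions

section PathFamilies

/-- An edge set that never separates consecutive edges of a path contains all or none of its
edges. -/
lemma forall_mem_or_forall_notMem_of_consecutive {V : Type} {G : SimpleGraph V} {C : Finset (Sym2 V)}
    {u v : V} (p : G.Walk u v) (hp : p.IsPath)
    (hC : ∀ x ∈ p.support, x ≠ u → x ≠ v → ∀ e₁ ∈ p.edges, ∀ e₂ ∈ p.edges, x ∈ e₁ → x ∈ e₂ →
      (e₁ ∈ C ↔ e₂ ∈ C)) :
    (∀ e ∈ p.edges, e ∈ C) ∨ ∀ e ∈ p.edges, e ∉ C := by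
  induction p with
  | nil => simp
  | @cons u w v h q ih =>
    have hp' := (SimpleGraph.Walk.cons_isPath_iff h q).1 hp
    have ih := ih hp'.1 fun x hx hxw hxv e₁ h₁ e₂ h₂ => by
      refine hC x (by simp [hx]) ?_ hxv e₁ (by simp [h₁]) e₂ (by simp [h₂])
      rintro rfl
      exact hp'.2 hx
    cases q with
    | nil => simpa using em (s(u, w) ∈ C)
    | @cons _ y _ h' q' =>
      have hq := (SimpleGraph.Walk.cons_isPath_iff h' q').1 hp'.1
      have hwv : w ≠ v := by
        rintro rfl
        exact hq.2 q'.end_mem_support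
      have hiff := hC w (by simp) h.ne' hwv s(u, w) (by simp) s(w, y) (by simp) (by simp) (by simp)
      have hy : s(w, y) ∈ (SimpleGraph.Walk.cons h' q').edges := by simp
      rcases ih with ih | ih
      · left
        intro e he
        rw [SimpleGraph.Walk.edges_cons, List.mem_cons] at he
        rcases he with rfl | he
        · exact hiff.2 (ih _ hy)
        · exact ih e he
      · right
        intro e he
        rw [SimpleGraph.Walk.edges_cons, List.mem_cons] at he
        rcases he with rfl | he
        · exact fun hc => ih _ hy (hiff.1 hc)
        · exact ih e he

variable {V : Type} [DecidableEq V]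

/-- The two degree conditions on a pair of edge sets that come from a pair of perfect matchings
of complementary gadget graphs. -/
def IsLinkPair (Z : Finset V) (C₁ C₂ : Finset (Sym2 V)) : Prop :=
  (∀ v, v ∉ Z → Even (edgeDeg C₁ v) ∧ Even (edgeDeg C₂ v)) ∧
    ∀ z ∈ Z, edgeDeg C₁ z + edgeDeg C₂ z = 1

/-- The union of the edge sets of the paths with index in `S`. -/
def pathUnion {G : SimpleGraph V} {k : ℕ} (f : Fin k → (u : V) × (v : V) × G.Walk u v)
    (S : Finset (Fin k)) : Finset (Sym2 V) :=
  S.biUnion fun i => (f i).2.2.edges.toFinset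

lemma mem_pathUnion {G : SimpleGraph V} {k : ℕ} {f : Fin k → (u : V) × (v : V) × G.Walk u v}
    {S : Finset (Fin k)} {e : Sym2 V} :
    e ∈ pathUnion f S ↔ ∃ i ∈ S, e ∈ (f i).2.2.edges := by
  simp [pathUnion]

/-- An edge set that has even degree at the inner vertices of a path, and no further edges there,
contains all or none of the edges of the path. -/
lemma forall_mem_or_forall_notMem_of_isPath {G : SimpleGraph V} {C : Finset (Sym2 V)}
    {u v : V} (p : G.Walk u v) (hp : p.IsPath)
    (hC : ∀ x ∈ p.support, x ≠ u → x ≠ v →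
      Even (edgeDeg C x) ∧ ∀ e ∈ C, x ∈ e → e ∈ p.edges) :
    (∀ e ∈ p.edges, e ∈ C) ∨ ∀ e ∈ p.edges, e ∉ C := by
  refine forall_mem_or_forall_notMem_of_consecutive p hp
    fun x hx hxu hxv e₁ h₁ e₂ h₂ hx₁ hx₂ => ?_
  obtain ⟨heven, hsub⟩ := hC x hx hxu hxv
  have hsub' : C.filter (x ∈ ·) ⊆ p.edges.toFinset.filter (x ∈ ·) := fun e he => by
    rw [Finset.mem_filter] at he ⊢
    exact ⟨List.mem_toFinset.2 (hsub e he.1 he.2), he.2⟩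
  have hdeg := edgeDeg_edges_of_isPath p hp x
  rw [if_pos hx, if_neg hxu, if_neg hxv] at hdeg
  have key : ∀ e ∈ p.edges, ∀ e' ∈ C, x ∈ e → x ∈ e' → e ∈ C := by
    intro e he e' he' hxe hxe'
    have hpos : 0 < edgeDeg C x := Finset.card_pos.2 ⟨e', Finset.mem_filter.2 ⟨he', hxe'⟩⟩
    obtain ⟨n, hn⟩ := heven
    have heq := Finset.eq_of_subset_of_card_le hsub'
      (show edgeDeg p.edges.toFinset x ≤ edgeDeg C x by omega)
    have hmem : e ∈ p.edges.toFinset.filter (x ∈ ·) :=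
      Finset.mem_filter.2 ⟨List.mem_toFinset.2 he, hxe⟩
    rw [← heq] at hmem
    exact (Finset.mem_filter.1 hmem).1
  exact ⟨fun h => key e₂ h₂ e₁ h hx₂ hx₁, fun h => key e₁ h₁ e₂ h hx₁ hx₂⟩

lemma IsPathFamily.injective_ends {G : SimpleGraph V} {A B : Finset V} {E' : Set (Sym2 V)} {k : ℕ}
    {f : Fin k → (u : V) × (v : V) × G.Walk u v} (hf : IsPathFamily G A B E' f)
    (hdisj : Disjoint A B) (hA : Even A.card) (hB : Even B.card) :
    (Finset.univ.image fun x : Fin k × Bool => cond x.2 (f x.1).1 (f x.1).2.1) = A ∪ B ∧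
    Function.Injective fun x : Fin k × Bool => cond x.2 (f x.1).1 (f x.1).2.1 := by
  obtain ⟨hk, -, htype, -, hcover, -⟩ := hf
  have himg : (Finset.univ.image fun x : Fin k × Bool => cond x.2 (f x.1).1 (f x.1).2.1)
      = A ∪ B := by
    ext z
    simp only [Finset.mem_image, Finset.mem_univ, true_and, Prod.exists, Bool.exists_bool,
      cond_false, cond_true]
    constructor
    · rintro ⟨i, h⟩
      have := htype i
      rw [Finset.mem_union]
      rcases h with rfl | rfl <;> tauto
    · intro hz
      obtain ⟨i, h⟩ := hcover z hz
      exact ⟨i, by tauto⟩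
  refine ⟨himg, ?_⟩
  rw [← Set.injOn_univ, ← Finset.coe_univ, ← Finset.card_image_iff, himg,
    Finset.card_union_of_disjoint hdisj, Finset.card_univ, Fintype.card_prod, Fintype.card_fin,
    Fintype.card_bool]
  obtain ⟨a, ha⟩ := hA
  obtain ⟨b, hb⟩ := hB
  omega

section

variable {G : SimpleGraph V} {A B : Finset V} {E' : Set (Sym2 V)} {k : ℕ}
    {f : Fin k → (u : V) × (v : V) × G.Walk u v}

lemma IsPathFamily.fst_ne_snd (hf : IsPathFamily G A B E' f)
    (hdisj : Disjoint A B) (hA : Even A.card) (hB : Even B.card) (i : Fin k) :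
    (f i).1 ≠ (f i).2.1 := by
  intro h
  have := @(hf.injective_ends hdisj hA hB).2 (i, true) (i, false) (by simpa using h)
  simp at this

lemma IsPathFamily.even_card (hf : IsPathFamily G A B E' f)
    (hdisj : Disjoint A B) (hA : Even A.card) (hB : Even B.card) {T : Finset V} (hT : T ⊆ A ∪ B)
    (h : ∀ i, (f i).1 ∈ T ↔ (f i).2.1 ∈ T) : Even T.card := by
  obtain ⟨himg, hinj⟩ := hf.injective_ends hdisj hA hB
  have : T.card = ∑ z ∈ A ∪ B, if z ∈ T then 1 else 0 := by
    rw [Finset.sum_ite_mem, Finset.inter_eq_right.2 hT]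
    simp
  rw [this, ← himg, Finset.sum_image hinj.injOn, Fintype.sum_prod_type]
  refine Finset.even_sum _ fun i _ => ?_
  rw [Fintype.sum_bool]
  simp only [cond_true, cond_false, h i]
  exact ⟨_, rfl⟩

lemma IsPathFamily.fst_mem_iff (hf : IsPathFamily G A B E' f) (hdisj : Disjoint A B) (i : Fin k) :
    (f i).1 ∈ A ↔ (f i).2.1 ∈ A := by
  have h1 := hf.2.2.1 i
  have h2 : ∀ x, x ∈ A → x ∉ B := fun _ h => Finset.disjoint_left.1 hdisj h
  grind

lemma IsPathFamily.coe_pathUnion_univ (hf : IsPathFamily G A B E' f) :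
    (pathUnion f Finset.univ : Set (Sym2 V)) = E' := by
  rw [hf.2.2.2.2.2]
  ext e
  simp [mem_pathUnion]

lemma IsPathFamily.edgeDeg_pathUnion (hf : IsPathFamily G A B E' f) (S : Finset (Fin k))
    {i : Fin k} {x : V} (hx : x ∈ (f i).2.2.support) :
    edgeDeg (pathUnion f S) x =
      if i ∈ S then edgeDeg (f i).2.2.edges.toFinset x else 0 := by
  have huniq : ∀ j, ∀ e ∈ (f j).2.2.edges, x ∈ e → j = i := by
    intro j e he hxe
    by_contra hji
    exact hf.2.2.2.1 j i hji x ((f j).2.2.mem_support_of_mem_edges he hxe) hx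
  split_ifs with hi
  · refine edgeDeg_congr fun e hxe => ?_
    rw [mem_pathUnion, List.mem_toFinset]
    constructor
    · rintro ⟨j, -, hj⟩
      rwa [← huniq j e hj hxe]
    · exact fun h => ⟨i, hi, h⟩
  · rw [edgeDeg, Finset.card_eq_zero, Finset.filter_eq_empty_iff]
    intro e he hxe
    obtain ⟨j, hj, hje⟩ := mem_pathUnion.1 he
    exact hi (huniq j e hje hxe ▸ hj)

lemma edgeDeg_pathUnion_eq_zero (S : Finset (Fin k))
    {x : V} (hx : ∀ i, x ∉ (f i).2.2.support) : edgeDeg (pathUnion f S) x = 0 := by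
  rw [edgeDeg, Finset.card_eq_zero, Finset.filter_eq_empty_iff]
  intro e he hxe
  obtain ⟨j, hj, hje⟩ := mem_pathUnion.1 he
  exact hx j ((f j).2.2.mem_support_of_mem_edges hje hxe)

/-- A terminal on a path of a family is one of its two endpoints. -/
lemma IsPathFamily.eq_end_of_mem_support (hf : IsPathFamily G A B E' f) {i : Fin k} {x : V}
    (hx : x ∈ (f i).2.2.support) (hxZ : x ∈ A ∪ B) : x = (f i).1 ∨ x = (f i).2.1 := by
  obtain ⟨j, hj⟩ := hf.2.2.2.2.1 x hxZ
  have hxj : x ∈ (f j).2.2.support := by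
    rcases hj with rfl | rfl
    · exact (f j).2.2.start_mem_support
    · exact (f j).2.2.end_mem_support
  by_cases hij : i = j
  · rwa [hij]
  · exact absurd hxj (hf.2.2.2.1 i j hij x hx)

lemma IsPathFamily.edgeDeg_path (hf : IsPathFamily G A B E' f)
    (hdisj : Disjoint A B) (hA : Even A.card) (hB : Even B.card)
    {i : Fin k} {x : V} (hx : x ∈ (f i).2.2.support) :
    edgeDeg (f i).2.2.edges.toFinset x = if x ∈ A ∪ B then 1 else 2 := by
  have h := edgeDeg_edges_of_isPath _ (hf.2.1 i) x
  rw [if_pos hx] at h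
  have hne := hf.fst_ne_snd hdisj hA hB i
  split_ifs with hxZ
  · rcases hf.eq_end_of_mem_support hx hxZ with rfl | rfl
    · rw [if_pos rfl, if_neg hne] at h
      omega
    · rw [if_pos rfl, if_neg hne.symm] at h
      omega
  · have := hf.2.2.1 i
    rw [Finset.mem_union] at hxZ
    rw [if_neg (by grind), if_neg (by grind)] at h
    omega

lemma IsPathFamily.isLinkPair (hf : IsPathFamily G A B E' f)
    (hdisj : Disjoint A B) (hA : Even A.card) (hB : Even B.card) (S : Finset (Fin k)) :
    IsLinkPair (A ∪ B) (pathUnion f S) (pathUnion f Sᶜ) := by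
  constructor
  · intro v hv
    by_cases h : ∃ i, v ∈ (f i).2.2.support
    · obtain ⟨i, hi⟩ := h
      rw [hf.edgeDeg_pathUnion S hi, hf.edgeDeg_pathUnion Sᶜ hi,
        hf.edgeDeg_path hdisj hA hB hi, if_neg hv]
      split_ifs <;> decide
    · push Not at h
      rw [edgeDeg_pathUnion_eq_zero S h, edgeDeg_pathUnion_eq_zero Sᶜ h]
      decide
  · intro z hz
    obtain ⟨i, hi⟩ : ∃ i, z ∈ (f i).2.2.support := by
      obtain ⟨i, rfl | rfl⟩ := hf.2.2.2.2.1 z hz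
      · exact ⟨i, (f i).2.2.start_mem_support⟩
      · exact ⟨i, (f i).2.2.end_mem_support⟩
    rw [hf.edgeDeg_pathUnion S hi, hf.edgeDeg_pathUnion Sᶜ hi,
      hf.edgeDeg_path hdisj hA hB hi, if_pos hz]
    by_cases h : i ∈ S <;> simp [h]

lemma IsPathFamily.isBalanced (hf : IsPathFamily G A B E' f)
    (hdisj : Disjoint A B) (hA : Even A.card) (hB : Even B.card) :
    IsBalanced A (pathUnion f Finset.univ) := by
  intro W hW
  refine hf.even_card hdisj hA hB
    (Finset.inter_subset_left.trans Finset.subset_union_left) fun i => ?_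
  have key : ∀ {a b : V} (q : G.Walk a b), (∀ e ∈ q.edges, e ∈ pathUnion f Finset.univ) →
      (a ∈ W ↔ b ∈ W) := by
    intro a b q
    induction q with
    | nil => simp
    | @cons a c b h q ih =>
      intro hq
      rw [← ih fun e he => hq e (by simp [he])]
      have hac : s(a, c) ∈ pathUnion f Finset.univ := hq _ (by simp)
      exact ⟨hW _ hac a (by simp) c (by simp), hW _ hac c (by simp) a (by simp)⟩
  rw [Finset.mem_inter, Finset.mem_inter, hf.fst_mem_iff hdisj i,
    key (f i).2.2 fun e he => mem_pathUnion.2 ⟨i, Finset.mem_univ _, he⟩]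

lemma IsPathFamily.even_card_edgeDeg_eq_one (hf : IsPathFamily G A B E' f)
    (hdisj : Disjoint A B) (hA : Even A.card) (hB : Even B.card) (S : Finset (Fin k)) :
    Even (A.filter fun a => edgeDeg (pathUnion f S) a = 1).card := by
  refine hf.even_card hdisj hA hB
    ((Finset.filter_subset _ _).trans Finset.subset_union_left) fun i => ?_
  have hiff := hf.fst_mem_iff hdisj i
  rw [Finset.mem_filter, Finset.mem_filter, ← hiff]
  refine and_congr_right fun h1 => ?_
  rw [hf.edgeDeg_pathUnion S (f i).2.2.start_mem_support,
    hf.edgeDeg_pathUnion S (f i).2.2.end_mem_support,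
    hf.edgeDeg_path hdisj hA hB (f i).2.2.start_mem_support,
    hf.edgeDeg_path hdisj hA hB (f i).2.2.end_mem_support,
    if_pos (Finset.mem_union_left _ h1), if_pos (Finset.mem_union_left _ (hiff.1 h1))]

lemma IsPathFamily.eq_of_mem_edges (hf : IsPathFamily G A B E' f) {i j : Fin k} {e : Sym2 V}
    (hi : e ∈ (f i).2.2.edges) (hj : e ∈ (f j).2.2.edges) : i = j := by
  by_contra hij
  induction e with
  | _ x y =>
    exact hf.2.2.2.1 i j hij x ((f i).2.2.fst_mem_support_of_mem_edges hi)
      ((f j).2.2.fst_mem_support_of_mem_edges hj)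

lemma IsPathFamily.exists_mem_edges (hf : IsPathFamily G A B E' f)
    (hdisj : Disjoint A B) (hA : Even A.card) (hB : Even B.card) (i : Fin k) :
    ∃ e, e ∈ (f i).2.2.edges := by
  have hne := hf.fst_ne_snd hdisj hA hB i
  apply List.exists_mem_of_ne_nil
  intro h
  exact hne (SimpleGraph.Walk.eq_of_length_eq_zero
    (by rw [← SimpleGraph.Walk.length_edges, h, List.length_nil]))

lemma IsPathFamily.pathUnion_injective (hf : IsPathFamily G A B E' f)
    (hdisj : Disjoint A B) (hA : Even A.card) (hB : Even B.card) :
    Function.Injective (pathUnion f) := by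
  intro S T hST
  ext i
  obtain ⟨e, he⟩ := hf.exists_mem_edges hdisj hA hB i
  have key : ∀ S, e ∈ pathUnion f S ↔ i ∈ S := by
    intro S
    rw [mem_pathUnion]
    constructor
    · rintro ⟨j, hj, hje⟩
      rwa [hf.eq_of_mem_edges he hje]
    · exact fun h => ⟨i, h, he⟩
  rw [← key, ← key, hST]

lemma IsPathFamily.exists_pathUnion_eq (hf : IsPathFamily G A B E' f)
    {C₁ C₂ : Finset (Sym2 V)} (hC : IsLinkPair (A ∪ B) C₁ C₂) (hdisjC : Disjoint C₁ C₂)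
    (hunion : C₁ ∪ C₂ = pathUnion f Finset.univ) :
    ∃ S, C₁ = pathUnion f S ∧ C₂ = pathUnion f Sᶜ := by
  have hmem : ∀ e, e ∈ C₁ ∨ e ∈ C₂ ↔ ∃ i, e ∈ (f i).2.2.edges := by
    intro e
    rw [← Finset.mem_union, hunion, mem_pathUnion]
    simp
  have hnot : ∀ e ∈ C₁, e ∉ C₂ := fun e h1 h2 => Finset.disjoint_left.1 hdisjC h1 h2
  have huniform : ∀ i, (∀ e ∈ (f i).2.2.edges, e ∈ C₁) ∨ ∀ e ∈ (f i).2.2.edges, e ∉ C₁ := by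
    intro i
    refine forall_mem_or_forall_notMem_of_isPath _ (hf.2.1 i) fun x hx hxu hxv => ⟨?_, ?_⟩
    · refine (hC.1 x fun hxZ => ?_).1
      rcases hf.eq_end_of_mem_support hx hxZ with h | h
      · exact hxu h
      · exact hxv h
    · intro e he hxe
      obtain ⟨j, hj⟩ := (hmem e).1 (Or.inl he)
      by_cases hij : i = j
      · rwa [hij]
      · exact absurd ((f j).2.2.mem_support_of_mem_edges hj hxe) (hf.2.2.2.1 i j hij x hx)
  classical
  refine ⟨Finset.univ.filter fun i => ∀ e ∈ (f i).2.2.edges, e ∈ C₁, ?_, ?_⟩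
  · ext e
    simp only [mem_pathUnion, Finset.mem_filter, Finset.mem_univ, true_and]
    constructor
    · intro he
      obtain ⟨i, hi⟩ := (hmem e).1 (Or.inl he)
      exact ⟨i, (huniform i).resolve_right fun h => h e hi he, hi⟩
    · rintro ⟨i, h, hi⟩
      exact h e hi
  · ext e
    simp only [mem_pathUnion, Finset.mem_compl, Finset.mem_filter, Finset.mem_univ, true_and]
    constructor
    · intro he
      obtain ⟨i, hi⟩ := (hmem e).1 (Or.inr he)
      exact ⟨i, fun h => hnot e (h e hi) he, hi⟩
    · rintro ⟨i, h, hi⟩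
      exact ((hmem e).2 ⟨i, hi⟩).resolve_left ((huniform i).resolve_left h e hi)

end

end PathFamilies

section Cancellation

variable {V : Type} [DecidableEq V]

/-- Exchange the parts of `C₁` and `C₂` that touch the vertex set `W`; this is the first
component of the resulting pair. -/
def swapOn (W : Finset V) (C₁ C₂ : Finset (Sym2 V)) : Finset (Sym2 V) :=
  C₁.filter (fun e => ¬ ∃ x ∈ W, x ∈ e) ∪ C₂.filter (fun e => ∃ x ∈ W, x ∈ e)

lemma mem_swapOn_of_touch {W : Finset V} {C₁ C₂ : Finset (Sym2 V)} {e : Sym2 V}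
    (h : ∃ x ∈ W, x ∈ e) : e ∈ swapOn W C₁ C₂ ↔ e ∈ C₂ := by
  simp only [swapOn, Finset.mem_union, Finset.mem_filter, h, not_true_eq_false, and_false,
    false_or, and_true]

lemma mem_swapOn_of_not_touch {W : Finset V} {C₁ C₂ : Finset (Sym2 V)} {e : Sym2 V}
    (h : ¬ ∃ x ∈ W, x ∈ e) : e ∈ swapOn W C₁ C₂ ↔ e ∈ C₁ := by
  simp only [swapOn, Finset.mem_union, Finset.mem_filter, h, not_false_eq_true, and_false,
    or_false, and_true]

lemma symmDiff_swapOn (W : Finset V) (C₁ C₂ : Finset (Sym2 V)) :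
    symmDiff (swapOn W C₁ C₂) (swapOn W C₂ C₁) = symmDiff C₁ C₂ := by
  ext e
  rw [Finset.mem_symmDiff, Finset.mem_symmDiff]
  by_cases h : ∃ x ∈ W, x ∈ e
  · rw [mem_swapOn_of_touch h, mem_swapOn_of_touch h]
    tauto
  · rw [mem_swapOn_of_not_touch h, mem_swapOn_of_not_touch h]

lemma swapOn_swapOn (W : Finset V) (C₁ C₂ : Finset (Sym2 V)) :
    swapOn W (swapOn W C₁ C₂) (swapOn W C₂ C₁) = C₁ := by
  ext e
  by_cases h : ∃ x ∈ W, x ∈ e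
  · rw [mem_swapOn_of_touch h, mem_swapOn_of_touch h]
  · rw [mem_swapOn_of_not_touch h, mem_swapOn_of_not_touch h]

lemma swapOn_subset {W : Finset V} {C₁ C₂ E : Finset (Sym2 V)} (h₁ : C₁ ⊆ E) (h₂ : C₂ ⊆ E) :
    swapOn W C₁ C₂ ⊆ E :=
  Finset.union_subset ((Finset.filter_subset _ _).trans h₁) ((Finset.filter_subset _ _).trans h₂)

lemma sum_swapOn (W : Finset V) (C₁ C₂ : Finset (Sym2 V)) (ℓ : Sym2 V → ℕ) :
    ∑ e ∈ swapOn W C₁ C₂, ℓ e + ∑ e ∈ swapOn W C₂ C₁, ℓ e = ∑ e ∈ C₁, ℓ e + ∑ e ∈ C₂, ℓ e := by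
  have h : ∀ C D : Finset (Sym2 V), Disjoint (C.filter fun e => ¬ ∃ x ∈ W, x ∈ e)
      (D.filter fun e => ∃ x ∈ W, x ∈ e) := fun C D =>
    Finset.disjoint_left.2 fun e h1 h2 => (Finset.mem_filter.1 h1).2 (Finset.mem_filter.1 h2).2
  rw [swapOn, swapOn, Finset.sum_union (h _ _), Finset.sum_union (h _ _),
    ← Finset.sum_filter_add_sum_filter_not C₁ (fun e => ∃ x ∈ W, x ∈ e),
    ← Finset.sum_filter_add_sum_filter_not C₂ (fun e => ∃ x ∈ W, x ∈ e)]
  ring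

lemma edgeDeg_swapOn {W : Finset V} {C₁ C₂ : Finset (Sym2 V)}
    (hW : IsClosedUnder (symmDiff C₁ C₂) W) (v : V) :
    edgeDeg (swapOn W C₁ C₂) v = if v ∈ W then edgeDeg C₂ v else edgeDeg C₁ v := by
  split_ifs with hv
  · exact edgeDeg_congr fun e he => mem_swapOn_of_touch ⟨v, hv, he⟩
  · refine edgeDeg_congr fun e he => ?_
    by_cases h : ∃ x ∈ W, x ∈ e
    · rw [mem_swapOn_of_touch h]
      obtain ⟨x, hx, hxe⟩ := h
      have : e ∉ symmDiff C₁ C₂ := fun hD => hv (hW e hD x hxe v he hx)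
      rw [Finset.mem_symmDiff] at this
      tauto
    · exact mem_swapOn_of_not_touch h

lemma IsLinkPair.swapOn {Z W : Finset V} {C₁ C₂ : Finset (Sym2 V)} (h : IsLinkPair Z C₁ C₂)
    (hW : IsClosedUnder (symmDiff C₁ C₂) W) :
    IsLinkPair Z (swapOn W C₁ C₂) (swapOn W C₂ C₁) := by
  have hW' : IsClosedUnder (symmDiff C₂ C₁) W := by rwa [symmDiff_comm]
  constructor
  · intro v hv
    have := h.1 v hv
    rw [edgeDeg_swapOn hW, edgeDeg_swapOn hW']
    split_ifs <;> tauto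
  · intro z hz
    have := h.2 z hz
    rw [edgeDeg_swapOn hW, edgeDeg_swapOn hW']
    split_ifs <;> omega

/-- The sign of a link pair with first component `C`: the parity of the number of vertices of `A`
that are covered by `C`. -/
def linkSign (A : Finset V) (C : Finset (Sym2 V)) : ℤ :=
  (-1) ^ (A.filter fun a => edgeDeg C a = 1).card

lemma linkSign_swapOn {A Z W : Finset V} {C₁ C₂ : Finset (Sym2 V)} (hAZ : A ⊆ Z)
    (h : IsLinkPair Z C₁ C₂) (hW : IsClosedUnder (symmDiff C₁ C₂) W) (hodd : ¬ Even (A ∩ W).card) :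
    linkSign A C₁ + linkSign A (swapOn W C₁ C₂) = 0 := by
  have h1 : (A.filter fun a => edgeDeg C₁ a = 1).card =
      ((A ∩ W).filter fun a => edgeDeg C₁ a = 1).card +
        ((A \ W).filter fun a => edgeDeg C₁ a = 1).card := by
    rw [← Finset.card_union_of_disjoint (Finset.disjoint_filter_filter
      (Finset.disjoint_sdiff_inter A W).symm), ← Finset.filter_union,
      Finset.union_comm, Finset.sdiff_union_inter]
  have h2 : (A.filter fun a => edgeDeg (swapOn W C₁ C₂) a = 1).card =
      ((A ∩ W).filter fun a => ¬ edgeDeg C₁ a = 1).card +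
        ((A \ W).filter fun a => edgeDeg C₁ a = 1).card := by
    rw [← Finset.card_union_of_disjoint (Finset.disjoint_filter_filter
      (Finset.disjoint_sdiff_inter A W).symm)]
    congr 1
    ext a
    rw [Finset.mem_filter, edgeDeg_swapOn hW, Finset.mem_union, Finset.mem_filter,
      Finset.mem_filter, Finset.mem_inter, Finset.mem_sdiff]
    by_cases ha : a ∈ A
    · have := h.2 a (hAZ ha)
      by_cases haW : a ∈ W
      · simp only [ha, haW, if_true, true_and, not_true, false_and, or_false]
        omega
      · simp [ha, haW]
    · simp [ha]
  have h3 := Finset.card_filter_add_card_filter_not (s := A ∩ W) (fun a => edgeDeg C₁ a = 1)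
  rw [linkSign, linkSign, h1, h2, pow_add, pow_add, ← add_mul]
  convert zero_mul _
  rw [← h3, Nat.not_even_iff_odd] at hodd
  rcases Nat.even_or_odd ((A ∩ W).filter fun a => edgeDeg C₁ a = 1).card with h4 | h4
  · rw [h4.neg_one_pow, ((Nat.odd_add'.1 hodd).2 h4).neg_one_pow]
    ring
  · rw [h4.neg_one_pow, ((Nat.odd_add.1 hodd).1 h4).neg_one_pow]
    ring

open Classical in
/-- The pairs of subsets of `E` satisfying the degree conditions of `IsLinkPair`. -/
noncomputable def linkPairs [Fintype V] (E : Finset (Sym2 V)) (Z : Finset V) :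
    Finset (Finset (Sym2 V) × Finset (Sym2 V)) :=
  Finset.univ.filter fun c => c.1 ⊆ E ∧ c.2 ⊆ E ∧ IsLinkPair Z c.1 c.2

lemma mem_linkPairs [Fintype V] {E : Finset (Sym2 V)} {Z : Finset V}
    {c : Finset (Sym2 V) × Finset (Sym2 V)} :
    c ∈ linkPairs E Z ↔ c.1 ⊆ E ∧ c.2 ⊆ E ∧ IsLinkPair Z c.1 c.2 := by
  simp [linkPairs]

open Classical in
/-- The contributions of the unbalanced link pairs of a given length cancel. -/
lemma sum_linkSign_not_isBalanced [Fintype V] {E : Finset (Sym2 V)} {A Z : Finset V} (hAZ : A ⊆ Z)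
    (ℓ : Sym2 V → ℕ) (m : ℕ) :
    ∑ c ∈ (linkPairs E Z).filter (fun c => ∑ e ∈ c.1, ℓ e + ∑ e ∈ c.2, ℓ e = m ∧
      ¬ IsBalanced A (symmDiff c.1 c.2)), linkSign A c.1 = 0 := by
  have hex : ∀ D : Finset (Sym2 V), ∃ W, ¬ IsBalanced A D →
      IsClosedUnder D W ∧ ¬ Even (A ∩ W).card := by
    intro D
    by_cases h : IsBalanced A D
    · exact ⟨∅, fun h' => absurd h h'⟩
    · unfold IsBalanced at h
      simp only [not_forall] at h
      obtain ⟨W, h1, h2⟩ := h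
      exact ⟨W, fun _ => ⟨h1, h2⟩⟩
  choose W hW using hex
  refine Finset.sum_involution
    (fun c _ => (swapOn (W (symmDiff c.1 c.2)) c.1 c.2, swapOn (W (symmDiff c.1 c.2)) c.2 c.1))
    ?_ ?_ ?_ ?_
  · intro c hc
    rw [Finset.mem_filter, mem_linkPairs] at hc
    obtain ⟨⟨-, -, hlink⟩, -, hbal⟩ := hc
    exact linkSign_swapOn hAZ hlink (hW _ hbal).1 (hW _ hbal).2
  · intro c hc hne heq
    rw [Finset.mem_filter, mem_linkPairs] at hc
    obtain ⟨⟨-, -, hlink⟩, -, hbal⟩ := hc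
    have := linkSign_swapOn hAZ hlink (hW _ hbal).1 (hW _ hbal).2
    have h1 : swapOn (W (symmDiff c.1 c.2)) c.1 c.2 = c.1 := congrArg Prod.fst heq
    rw [h1] at this
    omega
  · intro c hc
    rw [Finset.mem_filter, mem_linkPairs] at hc ⊢
    obtain ⟨⟨h1, h2, hlink⟩, hm, hbal⟩ := hc
    exact ⟨⟨swapOn_subset h1 h2, swapOn_subset h2 h1, hlink.swapOn (hW _ hbal).1⟩,
      (sum_swapOn _ _ _ _).trans hm, by rwa [symmDiff_swapOn]⟩
  · intro c hc
    simp only [symmDiff_swapOn, swapOn_swapOn]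

lemma sum_add_sum_eq_sum_symmDiff (C D : Finset (Sym2 V)) (ℓ : Sym2 V → ℕ) :
    ∑ e ∈ C, ℓ e + ∑ e ∈ D, ℓ e = ∑ e ∈ symmDiff C D, ℓ e + 2 * ∑ e ∈ C ∩ D, ℓ e := by
  rw [← Finset.sum_sdiff (Finset.inter_subset_left (s₁ := C) (s₂ := D)),
    ← Finset.sum_sdiff (Finset.inter_subset_right (s₁ := C) (s₂ := D)),
    Finset.sdiff_inter_self_left, Finset.sdiff_inter_self_right, symmDiff_def, Finset.sup_eq_union,
    Finset.sum_union (Finset.disjoint_left.2 fun e h1 h2 =>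
      (Finset.mem_sdiff.1 h2).2 (Finset.mem_sdiff.1 h1).1)]
  ring

end Cancellation

section Counting

variable {V : Type} [Fintype V] [DecidableEq V]

lemma IsLinkPair.exists_isSolution {G : SimpleGraph V} {A B : Finset V} {E : Finset (Sym2 V)}
    (hE : ∀ e ∈ E, e ∈ G.edgeSet) (hcubic : ∀ v, edgeDeg E v ≤ 3) (hdisj : Disjoint A B)
    {C₁ C₂ : Finset (Sym2 V)} (h₁ : C₁ ⊆ E) (h₂ : C₂ ⊆ E) (h : IsLinkPair (A ∪ B) C₁ C₂)
    (hbal : IsBalanced A (symmDiff C₁ C₂)) :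
    ∃ E' : Finset (Sym2 V), E' ⊆ symmDiff C₁ C₂ ∧ IsSolution G A B (E' : Set (Sym2 V)) := by
  have hsub : symmDiff C₁ C₂ ⊆ E := by
    intro e he
    rw [Finset.mem_symmDiff] at he
    rcases he with he | he
    · exact h₁ he.1
    · exact h₂ he.1
  have hZ : ∀ z ∈ A ∪ B, edgeDeg (symmDiff C₁ C₂) z = 1 := by
    intro z hz
    have := edgeDeg_symmDiff C₁ C₂ z
    have := h.2 z hz
    omega
  have heven : ∀ v, v ∉ A ∪ B → Even (edgeDeg (symmDiff C₁ C₂) v) := by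
    intro v hv
    have := edgeDeg_symmDiff C₁ C₂ v
    obtain ⟨⟨a, ha⟩, b, hb⟩ := h.1 v hv
    exact ⟨a + b - edgeDeg (C₁ ∩ C₂) v, by omega⟩
  refine exists_isSolution_subset (fun e he => hE e (hsub he)) hdisj hZ heven (fun v => ?_) hbal
  by_cases hv : v ∈ A ∪ B
  · rw [hZ v hv]
    exact one_le_two
  · have := (edgeDeg_mono hsub v).trans (hcubic v)
    obtain ⟨a, ha⟩ := heven v hv
    omega

variable {G : SimpleGraph V} {A B : Finset V} {E : Finset (Sym2 V)} {ℓ : Sym2 V → ℕ} {l : ℕ}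

/-- The total length of a balanced link pair is at least the minimum length of a solution, with
equality only for partitions of minimum solutions. -/
lemma IsLinkPair.le_length (hE : ∀ e ∈ E, e ∈ G.edgeSet) (hcubic : ∀ v, edgeDeg E v ≤ 3)
    (hℓ : ∀ e ∈ E, 1 ≤ ℓ e) (hdisj : Disjoint A B)
    (hmin : ∀ E' : Finset (Sym2 V), IsSolution G A B (E' : Set (Sym2 V)) → l ≤ ∑ e ∈ E', ℓ e)
    {C₁ C₂ : Finset (Sym2 V)} (h₁ : C₁ ⊆ E) (h₂ : C₂ ⊆ E) (h : IsLinkPair (A ∪ B) C₁ C₂)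
    (hbal : IsBalanced A (symmDiff C₁ C₂)) :
    l ≤ ∑ e ∈ C₁, ℓ e + ∑ e ∈ C₂, ℓ e ∧
      (∑ e ∈ C₁, ℓ e + ∑ e ∈ C₂, ℓ e = l → Disjoint C₁ C₂ ∧
        IsSolution G A B (symmDiff C₁ C₂ : Finset (Sym2 V)) ∧
        ∑ e ∈ symmDiff C₁ C₂, ℓ e = l) := by
  obtain ⟨E', hE', hsol⟩ := h.exists_isSolution hE hcubic hdisj h₁ h₂ hbal
  have hl := hmin E' hsol
  have hsum := sum_add_sum_eq_sum_symmDiff C₁ C₂ ℓ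
  have hsplit := Finset.sum_sdiff hE' (f := ℓ)
  refine ⟨by omega, fun hm => ?_⟩
  have hempty : ∀ C ⊆ E, ∑ e ∈ C, ℓ e = 0 → C = ∅ := by
    intro C hC h0
    rw [Finset.eq_empty_iff_forall_notMem]
    intro e he
    have := hℓ e (hC he)
    have := Finset.sum_eq_zero_iff.1 h0 e he
    omega
  have hsub : symmDiff C₁ C₂ ⊆ E := by
    intro e he
    rw [Finset.mem_symmDiff] at he
    rcases he with he | he
    · exact h₁ he.1
    · exact h₂ he.1
  have hI := hempty (C₁ ∩ C₂) (Finset.inter_subset_left.trans h₁) (by omega)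
  have hD := hempty (symmDiff C₁ C₂ \ E') (Finset.sdiff_subset.trans hsub) (by omega)
  have hDE : symmDiff C₁ C₂ = E' := (Finset.sdiff_eq_empty_iff_subset.1 hD).antisymm hE'
  exact ⟨Finset.disjoint_iff_inter_eq_empty.2 hI, hDE ▸ hsol, by omega⟩

lemma sum_linkSign_of_lt (hE : ∀ e ∈ E, e ∈ G.edgeSet) (hcubic : ∀ v, edgeDeg E v ≤ 3)
    (hℓ : ∀ e ∈ E, 1 ≤ ℓ e) (hdisj : Disjoint A B)
    (hmin : ∀ E' : Finset (Sym2 V), IsSolution G A B (E' : Set (Sym2 V)) → l ≤ ∑ e ∈ E', ℓ e)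
    {m : ℕ} (hm : m < l) :
    ∑ c ∈ (linkPairs E (A ∪ B)).filter (fun c => ∑ e ∈ c.1, ℓ e + ∑ e ∈ c.2, ℓ e = m),
      linkSign A c.1 = 0 := by
  classical
  rw [← sum_linkSign_not_isBalanced (E := E) Finset.subset_union_left ℓ m]
  congr 1
  refine Finset.filter_congr fun c hc => ?_
  rw [mem_linkPairs] at hc
  refine ⟨fun h => ⟨h, fun hbal => ?_⟩, And.left⟩
  have := (hc.2.2.le_length hE hcubic hℓ hdisj hmin hc.1 hc.2.1 hbal).1
  omega

lemma symmDiff_pathUnion_compl {k : ℕ} {f : Fin k → (u : V) × (v : V) × G.Walk u v}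
    {E' : Set (Sym2 V)} (hf : IsPathFamily G A B E' f) (S : Finset (Fin k)) :
    Disjoint (pathUnion f S) (pathUnion f Sᶜ) ∧
      symmDiff (pathUnion f S) (pathUnion f Sᶜ) = pathUnion f Finset.univ := by
  have hdisj : Disjoint (pathUnion f S) (pathUnion f Sᶜ) := by
    rw [Finset.disjoint_left]
    intro e h1 h2
    obtain ⟨i, hi, hie⟩ := mem_pathUnion.1 h1
    obtain ⟨j, hj, hje⟩ := mem_pathUnion.1 h2
    rw [hf.eq_of_mem_edges hie hje] at hi
    exact (Finset.mem_compl.1 hj) hi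
  refine ⟨hdisj, ?_⟩
  rw [hdisj.symmDiff_eq_sup, Finset.sup_eq_union, pathUnion, pathUnion, ← Finset.union_biUnion,
    Finset.union_compl]
  rfl

open Classical in
theorem sum_linkSign_eq (hE : ∀ e, e ∈ E ↔ e ∈ G.edgeSet) (hcubic : ∀ v, edgeDeg E v ≤ 3)
    (hℓ : ∀ e ∈ E, 1 ≤ ℓ e) (hdisj : Disjoint A B) (hA : Even A.card) (hB : Even B.card)
    (hmin : ∀ E' : Finset (Sym2 V), IsSolution G A B (E' : Set (Sym2 V)) → l ≤ ∑ e ∈ E', ℓ e) :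
    ∑ c ∈ (linkPairs E (A ∪ B)).filter (fun c => ∑ e ∈ c.1, ℓ e + ∑ e ∈ c.2, ℓ e = l),
      linkSign A c.1 = 2 ^ ((A ∪ B).card / 2) *
        ((Finset.univ.filter fun D : Finset (Sym2 V) =>
          IsSolution G A B (D : Set (Sym2 V)) ∧ ∑ e ∈ D, ℓ e = l).card : ℤ) := by
  rw [← Finset.sum_filter_add_sum_filter_not _ (fun c => IsBalanced A (symmDiff c.1 c.2)),
    Finset.filter_filter, Finset.filter_filter,
    sum_linkSign_not_isBalanced Finset.subset_union_left, add_zero]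
  set P := (linkPairs E (A ∪ B)).filter (fun c => ∑ e ∈ c.1, ℓ e + ∑ e ∈ c.2, ℓ e = l ∧
    IsBalanced A (symmDiff c.1 c.2)) with hP
  set sol := Finset.univ.filter fun D : Finset (Sym2 V) =>
    IsSolution G A B (D : Set (Sym2 V)) ∧ ∑ e ∈ D, ℓ e = l with hsol
  have hmemP : ∀ c, c ∈ P → Disjoint c.1 c.2 ∧ symmDiff c.1 c.2 ∈ sol := by
    intro c hc
    rw [hP, Finset.mem_filter, mem_linkPairs] at hc
    obtain ⟨⟨h1, h2, hlink⟩, hm, hbal⟩ := hc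
    have := (hlink.le_length (fun e he => (hE e).1 he) hcubic hℓ hdisj hmin h1 h2 hbal).2 hm
    exact ⟨this.1, Finset.mem_filter.2 ⟨Finset.mem_univ _, this.2⟩⟩
  rw [← Finset.sum_fiberwise_of_maps_to (g := fun c => symmDiff c.1 c.2)
    (fun c hc => (hmemP c hc).2), mul_comm, ← nsmul_eq_mul]
  refine Finset.sum_eq_card_nsmul fun D hD => ?_
  obtain ⟨⟨k, f, hf⟩, hlen⟩ := (Finset.mem_filter.1 hD).2
  have hDf : pathUnion f Finset.univ = D := Finset.coe_injective hf.coe_pathUnion_univ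
  have hDE : D ⊆ E := by
    intro e he
    rw [← hDf, mem_pathUnion] at he
    obtain ⟨i, -, hi⟩ := he
    exact (hE e).2 ((f i).2.2.edges_subset_edgeSet hi)
  have hfiber : P.filter (fun c => symmDiff c.1 c.2 = D) =
      Finset.univ.image fun S : Finset (Fin k) => (pathUnion f S, pathUnion f Sᶜ) := by
    ext ⟨C₁, C₂⟩
    rw [Finset.mem_filter, Finset.mem_image]
    constructor
    · rintro ⟨hc, hcD⟩
      have hdC := (hmemP _ hc).1
      rw [hP, Finset.mem_filter, mem_linkPairs] at hc
      obtain ⟨S, h1, h2⟩ := hf.exists_pathUnion_eq hc.1.2.2 hdC (by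
        rw [hDf, ← hcD]
        exact hdC.symmDiff_eq_sup.symm)
      exact ⟨S, Finset.mem_univ _, Prod.ext h1.symm h2.symm⟩
    · rintro ⟨S, -, hS⟩
      obtain ⟨rfl, rfl⟩ := Prod.mk.inj hS
      obtain ⟨hdC, hsymm⟩ := symmDiff_pathUnion_compl hf S
      have hsub : ∀ T, pathUnion f T ⊆ E := fun T =>
        (Finset.biUnion_subset_biUnion_of_subset_left _ (Finset.subset_univ T)).trans
          (hDf.subset.trans hDE)
      refine ⟨?_, hsymm.trans hDf⟩
      rw [hP, Finset.mem_filter, mem_linkPairs]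
      refine ⟨⟨hsub _, hsub _, hf.isLinkPair hdisj hA hB S⟩, ?_, ?_⟩
      · rw [sum_add_sum_eq_sum_symmDiff, hsymm, hDf, Finset.disjoint_iff_inter_eq_empty.1 hdC, hlen]
        simp
      · rw [hsymm]
        exact hf.isBalanced hdisj hA hB
  rw [hfiber, Finset.sum_image fun S _ T _ h =>
    hf.pathUnion_injective hdisj hA hB (congrArg Prod.fst h)]
  have hone : ∀ S, linkSign A (pathUnion f S) = 1 := fun S =>
    (hf.even_card_edgeDeg_eq_one hdisj hA hB S).neg_one_pow
  simp only [hone, Finset.sum_const, Finset.card_univ, Fintype.card_finset, Fintype.card_fin]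
  rw [Finset.card_union_of_disjoint hdisj, ← hf.1]
  simp

end Counting

section Gadgets

variable {V : Type}

/-- `inc v i` is the edge of `G` at `v` to which `idx` assigns the index `i`. -/
structure IsPortMap (G : SimpleGraph V) (idx : V → Sym2 V → Fin 3) (inc : V → Fin 3 → Sym2 V) :
    Prop where
  mem_edgeSet : ∀ v i, inc v i ∈ G.edgeSet
  mem : ∀ v i, v ∈ inc v i
  idx_inc : ∀ v i, idx v (inc v i) = i
  inc_idx : ∀ v, ∀ e ∈ G.edgeSet, v ∈ e → inc v (idx v e) = e

lemma exists_isPortMap [Fintype V] {G : SimpleGraph V} {idx : V → Sym2 V → Fin 3}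
    (hcubic : ∀ v : V, (G.neighborSet v).ncard = 3)
    (hidx : ∀ v : V, Set.InjOn (idx v) (G.incidenceSet v)) : ∃ inc, IsPortMap G idx inc := by
  classical
  have hsurj : ∀ v i, ∃ e ∈ G.incidenceSet v, idx v e = i := by
    intro v i
    have hcard : (idx v '' G.incidenceSet v).ncard = 3 := by
      rw [(hidx v).ncard_image, ← hcubic v]
      exact Nat.card_congr (G.incidenceSetEquivNeighborSet v)
    have : idx v '' G.incidenceSet v = Set.univ := by
      apply Set.eq_of_subset_of_ncard_le (Set.subset_univ _)
      rw [hcard, Set.ncard_univ, Nat.card_fin]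
    have hi : i ∈ idx v '' G.incidenceSet v := this ▸ Set.mem_univ i
    exact hi
  choose inc h1 h2 using hsurj
  exact ⟨inc, fun v i => (h1 v i).1, fun v i => (h1 v i).2, h2, fun v e he hv =>
    hidx v (h1 v _) ⟨he, hv⟩ (h2 v _)⟩

variable {G : SimpleGraph V} {idx : V → Sym2 V → Fin 3} {inc : V → Fin 3 → Sym2 V}

lemma IsPortMap.eq_inc_iff (h : IsPortMap G idx inc) {v : V} {i : Fin 3} {e : Sym2 V}
    (he : e ∈ G.edgeSet) : e = inc v i ↔ v ∈ e ∧ idx v e = i := by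
  constructor
  · rintro rfl
    exact ⟨h.mem v i, h.idx_inc v i⟩
  · rintro ⟨hv, rfl⟩
    exact (h.inc_idx v e he hv).symm

lemma IsPortMap.injective (h : IsPortMap G idx inc) (v : V) : Function.Injective (inc v) := by
  intro i j hij
  rw [← h.idx_inc v i, hij, h.idx_inc]

lemma IsPortMap.edgeDeg_eq [DecidableEq V] (h : IsPortMap G idx inc) {C : Finset (Sym2 V)}
    (hC : ∀ e ∈ C, e ∈ G.edgeSet) (v : V) :
    edgeDeg C v = (Finset.univ.filter fun i => inc v i ∈ C).card := by
  rw [edgeDeg, ← Finset.card_image_of_injective _ (h.injective v)]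
  congr 1
  ext e
  simp only [Finset.mem_filter, Finset.mem_image, Finset.mem_univ, true_and]
  constructor
  · rintro ⟨he, hv⟩
    exact ⟨idx v e, by rw [h.inc_idx v e (hC e he) hv]; exact ⟨he, rfl⟩⟩
  · rintro ⟨i, hi, rfl⟩
    exact ⟨hi, h.mem v i⟩

lemma extEdge_mk (u w : V) :
    extEdge idx s(u, w) = s(Sum.inl (u, idx u s(u, w)), Sum.inl (w, idx w s(u, w))) := by
  change s(fEnd idx u w, fEnd idx w u) = _
  rw [fEnd, fEnd, Sym2.eq_swap (a := w) (b := u)]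

lemma inl_mem_extEdge {x : V} {i : Fin 3} {e : Sym2 V} :
    (Sum.inl (x, i) : HVert V) ∈ extEdge idx e ↔ x ∈ e ∧ idx x e = i := by
  induction e with
  | _ u w =>
    rw [extEdge_mk, Sym2.mem_iff, Sym2.mem_iff, Sum.inl.injEq, Sum.inl.injEq, Prod.mk.injEq,
      Prod.mk.injEq]
    grind

lemma inr_notMem_extEdge {z : V} {e : Sym2 V} : (Sum.inr z : HVert V) ∉ extEdge idx e := by
  induction e with
  | _ u w =>
    rw [extEdge_mk, Sym2.mem_iff]
    simp

/-- The edge between two ports in the gadget of a nonterminal. -/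
abbrev triEdge (v : V) (i j : Fin 3) : Sym2 (HVert V) := s(Sum.inl (v, i), Sum.inl (v, j))

/-- The edge between the center and a port in the gadget of a terminal. -/
abbrev starEdge (z : V) (i : Fin 3) : Sym2 (HVert V) := s(Sum.inr z, Sum.inl (z, i))

lemma IsPortMap.inl_mem_extEdge_iff (h : IsPortMap G idx inc) {v : V} {i : Fin 3} {e : Sym2 V}
    (he : e ∈ G.edgeSet) : (Sum.inl (v, i) : HVert V) ∈ extEdge idx e ↔ e = inc v i := by
  rw [inl_mem_extEdge, h.eq_inc_iff he]

lemma IsPortMap.extEdge_injOn (h : IsPortMap G idx inc) :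
    Set.InjOn (extEdge idx) G.edgeSet := by
  intro e he e' he' heq
  obtain ⟨v, hv⟩ : ∃ v, v ∈ e := by
    induction e with
    | _ u w => exact ⟨u, by simp⟩
  have hmem : (Sum.inl (v, idx v e) : HVert V) ∈ extEdge idx e := inl_mem_extEdge.2 ⟨hv, rfl⟩
  rw [(h.inl_mem_extEdge_iff he).1 hmem, (h.inl_mem_extEdge_iff he').1 (heq ▸ hmem)]

lemma IsPortMap.triEdge_ne_extEdge (h : IsPortMap G idx inc) {v : V} {i j : Fin 3} (hij : i ≠ j)
    {e : Sym2 V} (he : e ∈ G.edgeSet) : triEdge v i j ≠ extEdge idx e := by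
  intro heq
  have hi : e = inc v i := (h.inl_mem_extEdge_iff he).1 (heq ▸ Sym2.mem_mk_left _ _)
  have hj : e = inc v j := (h.inl_mem_extEdge_iff he).1 (heq ▸ Sym2.mem_mk_right _ _)
  exact hij (h.injective v (hi.symm.trans hj))

lemma starEdge_ne_extEdge {z : V} {i : Fin 3} {e : Sym2 V} : starEdge z i ≠ extEdge idx e := by
  intro heq
  have hm : (Sum.inr z : HVert V) ∈ starEdge z i := Sym2.mem_mk_left _ _
  rw [heq] at hm
  exact inr_notMem_extEdge hm

lemma extEdge_mem_gadgetGraph (Z : Finset V) {e : Sym2 V} (he : e ∈ G.edgeSet) :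
    extEdge idx e ∈ (gadgetGraph G idx Z).edgeSet := by
  induction e with
  | _ u w =>
    have hadj : G.Adj u w := he
    rw [extEdge_mk, SimpleGraph.mem_edgeSet, gadgetGraph, SimpleGraph.fromRel_adj]
    refine ⟨fun heq => hadj.ne ?_, Or.inl (Or.inr ⟨hadj, rfl, by rw [Sym2.eq_swap]⟩)⟩
    simp only [Sum.inl.injEq, Prod.mk.injEq] at heq
    exact heq.1

lemma triEdge_mem_gadgetGraph {Z : Finset V} {v : V} (hv : v ∉ Z) {i j : Fin 3} (hij : i ≠ j) :
    triEdge v i j ∈ (gadgetGraph G idx Z).edgeSet := by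
  rw [SimpleGraph.mem_edgeSet, gadgetGraph, SimpleGraph.fromRel_adj]
  exact ⟨by simpa using hij, Or.inl (Or.inl ⟨rfl, hv, hij⟩)⟩

lemma starEdge_mem_gadgetGraph {Z : Finset V} {z : V} (hz : z ∈ Z) (i : Fin 3) :
    starEdge z i ∈ (gadgetGraph G idx Z).edgeSet := by
  rw [SimpleGraph.mem_edgeSet, gadgetGraph, SimpleGraph.fromRel_adj]
  exact ⟨by simp, Or.inl ⟨hz, rfl⟩⟩

lemma exists_eq_of_hRel {Z : Finset V} {x y : HVert V} (h : hRel G idx Z x y) :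
    (∃ e ∈ G.edgeSet, s(x, y) = extEdge idx e) ∨
      (∃ v, v ∉ Z ∧ ∃ i j, i ≠ j ∧ s(x, y) = triEdge v i j) ∨
      ∃ z ∈ Z, ∃ i, s(x, y) = starEdge z i := by
  rcases x with ⟨u, i⟩ | z <;> rcases y with ⟨w, j⟩ | z'
  · rcases h with ⟨rfl, hu, hij⟩ | ⟨hadj, rfl, rfl⟩
    · exact Or.inr (Or.inl ⟨u, hu, i, j, hij, rfl⟩)
    · exact Or.inl ⟨s(u, w), hadj, by rw [extEdge_mk]⟩
  · exact h.elim
  · obtain ⟨hz, rfl⟩ := h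
    exact Or.inr (Or.inr ⟨z, hz, j, rfl⟩)
  · exact h.elim

/-- Every edge of the gadget graph is external or internal to a gadget. -/
lemma exists_eq_of_mem_gadgetGraph {Z : Finset V} {ε : Sym2 (HVert V)}
    (hε : ε ∈ (gadgetGraph G idx Z).edgeSet) :
    (∃ e ∈ G.edgeSet, ε = extEdge idx e) ∨
      (∃ v, v ∉ Z ∧ ∃ i j, i ≠ j ∧ ε = triEdge v i j) ∨ ∃ z ∈ Z, ∃ i, ε = starEdge z i := by
  induction ε with
  | _ x y =>
    rw [SimpleGraph.mem_edgeSet, gadgetGraph, SimpleGraph.fromRel_adj] at hε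
    rcases hε.2 with h | h
    · exact exists_eq_of_hRel h
    · rw [Sym2.eq_swap]
      exact exists_eq_of_hRel h

lemma IsPortMap.eq_of_inl_mem (h : IsPortMap G idx inc) {Z : Finset V} {ε : Sym2 (HVert V)}
    (hε : ε ∈ (gadgetGraph G idx Z).edgeSet) {v : V} {i : Fin 3} (hv : Sum.inl (v, i) ∈ ε) :
    ε = extEdge idx (inc v i) ∨ (v ∉ Z ∧ ∃ j, j ≠ i ∧ ε = triEdge v i j) ∨
      (v ∈ Z ∧ ε = starEdge v i) := by
  rcases exists_eq_of_mem_gadgetGraph hε with ⟨e, he, rfl⟩ | ⟨w, hw, a, b, hab, rfl⟩ |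
    ⟨z, hz, a, rfl⟩
  · rw [h.inl_mem_extEdge_iff he] at hv
    exact Or.inl (by rw [hv])
  · rw [Sym2.mem_iff, Sum.inl.injEq, Sum.inl.injEq, Prod.mk.injEq, Prod.mk.injEq] at hv
    rcases hv with ⟨rfl, rfl⟩ | ⟨rfl, rfl⟩
    · exact Or.inr (Or.inl ⟨hw, b, hab.symm, rfl⟩)
    · exact Or.inr (Or.inl ⟨hw, a, hab, Sym2.eq_swap⟩)
  · simp only [Sym2.mem_iff, reduceCtorEq, Sum.inl.injEq, Prod.mk.injEq, false_or] at hv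
    obtain ⟨rfl, rfl⟩ := hv
    exact Or.inr (Or.inr ⟨hz, rfl⟩)

lemma eq_of_inr_mem {Z : Finset V} {ε : Sym2 (HVert V)}
    (hε : ε ∈ (gadgetGraph G idx Z).edgeSet) {z : V} (hz : Sum.inr z ∈ ε) :
    ∃ i, ε = starEdge z i := by
  rcases exists_eq_of_mem_gadgetGraph hε with ⟨e, he, rfl⟩ | ⟨w, hw, a, b, hab, rfl⟩ |
    ⟨z, hz, a, rfl⟩
  · exact (inr_notMem_extEdge hz).elim
  · simp at hz
  · simp only [Sym2.mem_iff, reduceCtorEq, Sum.inr.injEq, or_false] at hz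
    exact ⟨a, by rw [hz]⟩

lemma triEdge_injective {v : V} {i j k : Fin 3} (hik : triEdge v i j = triEdge v i k) : j = k := by
  rw [Sym2.congr_right, Sum.inl.injEq, Prod.mk.injEq] at hik
  exact hik.2

lemma starEdge_injective {z : V} {i j : Fin 3} (h : starEdge z i = starEdge z j) : i = j := by
  rw [Sym2.congr_right, Sum.inl.injEq, Prod.mk.injEq] at h
  exact h.2

lemma Fin.even_card_filter_three (P : Fin 3 → Prop) [DecidablePred P]
    (h : ∀ i, P i → ∃ j, j ≠ i ∧ P j) (h' : ¬ ∀ i, P i) :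
    Even (Finset.univ.filter P).card := by
  have key : ∀ b : Fin 3 → Bool, (∀ i, b i = true → ∃ j, j ≠ i ∧ b j = true) →
      (¬ ∀ i, b i = true) → Even (Finset.univ.filter fun i => b i = true).card := by
    decide
  simpa using key (fun i => decide (P i)) (by simpa using h) (by simpa using h')

lemma Fin.existsUnique_of_even_card_three (P : Fin 3 → Prop) [DecidablePred P]
    (h : Even (Finset.univ.filter P).card) {i : Fin 3} (hi : P i) :
    ∃ j, j ≠ i ∧ P j ∧ ∀ k, k ≠ i → P k → k = j := by
  have key : ∀ b : Fin 3 → Bool, Even (Finset.univ.filter fun i => b i = true).card → ∀ i,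
      b i = true → ∃ j, j ≠ i ∧ b j = true ∧ ∀ k, k ≠ i → b k = true → k = j := by
    decide
  simpa using key (fun i => decide (P i)) (by simpa using h) i (by simpa using hi)

/-! ### Perfect matchings of the gadget graph -/

section

variable {Z X : Finset V} {M : Finset (Sym2 (HVert V))}

lemma IsPMgadget.eq_of_mem (hM : IsPMgadget G idx Z X M) {x : HVert V} (hx : x ∈ gadgetVerts X)
    {ε ε' : Sym2 (HVert V)} (h : ε ∈ M) (h' : ε' ∈ M) (hxε : x ∈ ε) (hxε' : x ∈ ε') : ε = ε' :=
  (hM.2 x hx).unique ⟨h, hxε⟩ ⟨h', hxε'⟩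

lemma inl_mem_gadgetVerts (x : V × Fin 3) : (Sum.inl x : HVert V) ∈ gadgetVerts X := trivial

/-- A port not covered by an external edge is covered by an internal edge. -/
lemma IsPMgadget.cover (h : IsPortMap G idx inc) (hM : IsPMgadget G idx Z X M) {v : V} {i : Fin 3}
    (hu : extEdge idx (inc v i) ∉ M) :
    (v ∉ Z ∧ ∃ j, j ≠ i ∧ triEdge v i j ∈ M) ∨ (v ∈ X ∧ starEdge v i ∈ M) := by
  obtain ⟨ε, hε, hvε⟩ := (hM.2 (Sum.inl (v, i)) (inl_mem_gadgetVerts _)).exists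
  rcases h.eq_of_inl_mem (hM.1 ε hε).1 hvε with rfl | ⟨hv, j, hj, rfl⟩ | ⟨hv, rfl⟩
  · exact absurd hε hu
  · exact Or.inl ⟨hv, j, hj, hε⟩
  · exact Or.inr ⟨(hM.1 _ hε).2 (Sum.inr v) (Sym2.mem_mk_left _ _), hε⟩

lemma IsPMgadget.extEdge_notMem_of_triEdge (h : IsPortMap G idx inc)
    (hM : IsPMgadget G idx Z X M) {v : V} {i j : Fin 3} (hij : i ≠ j) (ht : triEdge v i j ∈ M) :
    extEdge idx (inc v i) ∉ M := by
  intro he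
  refine h.triEdge_ne_extEdge hij (h.mem_edgeSet v i)
    (hM.eq_of_mem (inl_mem_gadgetVerts (v, i)) ht he (Sym2.mem_mk_left _ _) ?_)
  rw [h.inl_mem_extEdge_iff (h.mem_edgeSet v i)]

lemma IsPMgadget.triEdge_mem_iff (h : IsPortMap G idx inc) (hX : X ⊆ Z)
    (hM : IsPMgadget G idx Z X M) {v : V} (hv : v ∉ Z) {i j : Fin 3} (hij : i ≠ j) :
    triEdge v i j ∈ M ↔ extEdge idx (inc v i) ∉ M ∧ extEdge idx (inc v j) ∉ M := by
  constructor
  · intro ht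
    refine ⟨hM.extEdge_notMem_of_triEdge h hij ht, hM.extEdge_notMem_of_triEdge h hij.symm ?_⟩
    rwa [triEdge, Sym2.eq_swap]
  · rintro ⟨hi, hj⟩
    have hvX : v ∉ X := fun hvX => hv (hX hvX)
    rcases hM.cover h hi with ⟨-, a, ha, hta⟩ | ⟨hv', -⟩
    · rcases hM.cover h hj with ⟨-, b, hb, htb⟩ | ⟨hv', -⟩
      · by_cases haj : a = j
        · rwa [← haj]
        · by_cases hbi : b = i
          · rwa [triEdge, Sym2.eq_swap, ← hbi]
          · have hab : a = b := by omega
            subst hab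
            have heq := hM.eq_of_mem (inl_mem_gadgetVerts (v, a)) hta htb (Sym2.mem_mk_right _ _)
              (Sym2.mem_mk_right _ _)
            rw [Sym2.congr_left, Sum.inl.injEq, Prod.mk.injEq] at heq
            exact absurd heq.2 hij
      · exact absurd hv' hvX
    · exact absurd hv' hvX

lemma IsPMgadget.starEdge_mem_iff (h : IsPortMap G idx inc) (hX : X ⊆ Z)
    (hM : IsPMgadget G idx Z X M) {z : V} (hz : z ∈ X) {i : Fin 3} :
    starEdge z i ∈ M ↔ extEdge idx (inc z i) ∉ M := by
  constructor
  · intro hs he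
    refine starEdge_ne_extEdge
      (hM.eq_of_mem (inl_mem_gadgetVerts (z, i)) hs he (Sym2.mem_mk_right _ _) ?_)
    rw [h.inl_mem_extEdge_iff (h.mem_edgeSet z i)]
  · intro hu
    rcases hM.cover h hu with ⟨hz', -⟩ | ⟨-, hs⟩
    · exact absurd (hX hz) hz'
    · exact hs

end

end Gadgets

section GadgetMatchings

variable {V : Type} {G : SimpleGraph V} {idx : V → Sym2 V → Fin 3} {inc : V → Fin 3 → Sym2 V}

/-- The edge sets inside `E` with even degree off `Z`, degree one on `X` and degree zero on
`Z ∖ X`. -/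
def links [Fintype V] [DecidableEq V] (E : Finset (Sym2 V)) (Z X : Finset V) : Finset (Finset (Sym2 V)) :=
  E.powerset.filter fun C =>
    (∀ v ∉ Z, Even (edgeDeg C v)) ∧ ∀ z ∈ Z, edgeDeg C z = if z ∈ X then 1 else 0

lemma mem_links [Fintype V] [DecidableEq V] {E C : Finset (Sym2 V)} {Z X : Finset V} :
    C ∈ links E Z X ↔ C ⊆ E ∧
      (∀ v ∉ Z, Even (edgeDeg C v)) ∧ ∀ z ∈ Z, edgeDeg C z = if z ∈ X then 1 else 0 := by
  rw [links, Finset.mem_filter, Finset.mem_powerset]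

open Classical in
/-- The edges in `E` whose external edge is not in `M`. -/
noncomputable def freeEdges (idx : V → Sym2 V → Fin 3) (E : Finset (Sym2 V))
    (M : Finset (Sym2 (HVert V))) : Finset (Sym2 V) :=
  E.filter fun e => extEdge idx e ∉ M

lemma mem_freeEdges {E : Finset (Sym2 V)} {M : Finset (Sym2 (HVert V))} {e : Sym2 V} :
    e ∈ freeEdges idx E M ↔ e ∈ E ∧ extEdge idx e ∉ M := by
  simp only [freeEdges, Finset.mem_filter]

open Classical in
/-- The edges of the gadget graph that are external to `C`, or internal and join ports of `C`
or a center in `X` to a port of `C`. -/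
noncomputable def matchingOf [Fintype V] (idx : V → Sym2 V → Fin 3) (inc : V → Fin 3 → Sym2 V)
    (E : Finset (Sym2 V)) (Z X : Finset V) (C : Finset (Sym2 V)) : Finset (Sym2 (HVert V)) :=
  Finset.univ.filter fun ε =>
    (∃ e ∈ E, e ∉ C ∧ ε = extEdge idx e) ∨
    (∃ v, v ∉ Z ∧ ∃ i j, i ≠ j ∧ inc v i ∈ C ∧ inc v j ∈ C ∧ ε = triEdge v i j) ∨
    ∃ z ∈ X, ∃ i, inc z i ∈ C ∧ ε = starEdge z i

lemma starEdge_ne_triEdge {z v : V} {i j k : Fin 3} : starEdge z i ≠ triEdge v j k := by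
  simp [starEdge, triEdge]

lemma IsPortMap.wt_extEdge (h : IsPortMap G idx inc) (ℓ : Sym2 V → ℕ) {e : Sym2 V}
    (he : e ∈ G.edgeSet) : wt G ℓ idx (extEdge idx e) = Polynomial.X ^ ℓ e := by
  have hex : ∃ e', e' ∈ G.edgeSet ∧ extEdge idx e = extEdge idx e' := ⟨e, he, rfl⟩
  rw [wt, dif_pos hex, ← h.extEdge_injOn he hex.choose_spec.1 hex.choose_spec.2]

lemma prod_wt [DecidableEq V] {E : Finset (Sym2 V)} (h : IsPortMap G idx inc) (hE : ∀ e, e ∈ E ↔ e ∈ G.edgeSet)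
    (ℓ : Sym2 V → ℕ) (M : Finset (Sym2 (HVert V))) :
    ∏ ε ∈ M, wt G ℓ idx ε = Polynomial.X ^ (∑ e ∈ E \ freeEdges idx E M, ℓ e) := by
  have hmem : ∀ e, e ∈ E \ freeEdges idx E M ↔ e ∈ E ∧ extEdge idx e ∈ M := fun e => by
    rw [Finset.mem_sdiff, mem_freeEdges]
    tauto
  have hinj : Set.InjOn (extEdge idx) ((E \ freeEdges idx E M : Finset (Sym2 V)) : Set (Sym2 V)) :=
    h.extEdge_injOn.mono fun e he => (hE e).1 ((hmem e).1 he).1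
  rw [← Finset.prod_subset (s₁ := (E \ freeEdges idx E M).image (extEdge idx)),
    Finset.prod_image hinj, ← Finset.prod_pow_eq_pow_sum]
  · exact Finset.prod_congr rfl fun e he => h.wt_extEdge ℓ ((hE e).1 ((hmem e).1 he).1)
  · intro ε hε
    obtain ⟨e, he, rfl⟩ := Finset.mem_image.1 hε
    exact ((hmem e).1 he).2
  · intro ε hε hn
    rw [wt, dif_neg]
    rintro ⟨e, he, rfl⟩
    exact hn (Finset.mem_image_of_mem _ ((hmem e).2 ⟨(hE e).2 he, hε⟩))

variable [Fintype V] {E : Finset (Sym2 V)} {Z X : Finset V} {C : Finset (Sym2 V)}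

lemma mem_matchingOf {ε : Sym2 (HVert V)} :
    ε ∈ matchingOf idx inc E Z X C ↔
      (∃ e ∈ E, e ∉ C ∧ ε = extEdge idx e) ∨
      (∃ v, v ∉ Z ∧ ∃ i j, i ≠ j ∧ inc v i ∈ C ∧ inc v j ∈ C ∧ ε = triEdge v i j) ∨
      ∃ z ∈ X, ∃ i, inc z i ∈ C ∧ ε = starEdge z i := by
  simp only [matchingOf, Finset.mem_filter, Finset.mem_univ, true_and]

lemma extEdge_mem_matchingOf (h : IsPortMap G idx inc) (hE : ∀ e, e ∈ E ↔ e ∈ G.edgeSet)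
    {e : Sym2 V} (he : e ∈ E) : extEdge idx e ∈ matchingOf idx inc E Z X C ↔ e ∉ C := by
  rw [mem_matchingOf]
  constructor
  · rintro (⟨e', he', hC, heq⟩ | ⟨v, -, i, j, hij, -, -, heq⟩ | ⟨z, -, i, -, heq⟩)
    · rwa [h.extEdge_injOn ((hE e).1 he) ((hE e').1 he') heq]
    · exact absurd heq.symm (h.triEdge_ne_extEdge hij ((hE e).1 he))
    · exact absurd heq.symm starEdge_ne_extEdge
  · exact fun hC => Or.inl ⟨e, he, hC, rfl⟩

lemma triEdge_mem_matchingOf (h : IsPortMap G idx inc) (hE : ∀ e, e ∈ E ↔ e ∈ G.edgeSet)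
    {v : V} {i j : Fin 3} (hij : i ≠ j) :
    triEdge v i j ∈ matchingOf idx inc E Z X C ↔ v ∉ Z ∧ inc v i ∈ C ∧ inc v j ∈ C := by
  rw [mem_matchingOf]
  constructor
  · rintro (⟨e', he', hC, heq⟩ | ⟨w, hw, a, b, hab, ha, hb, heq⟩ | ⟨z, -, i, -, heq⟩)
    · exact absurd heq (h.triEdge_ne_extEdge hij ((hE e').1 he'))
    · simp only [triEdge, Sym2.eq_iff, Sum.inl.injEq, Prod.mk.injEq] at heq
      rcases heq with ⟨⟨rfl, rfl⟩, -, rfl⟩ | ⟨⟨rfl, rfl⟩, -, rfl⟩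
      · exact ⟨hw, ha, hb⟩
      · exact ⟨hw, hb, ha⟩
    · exact absurd heq.symm starEdge_ne_triEdge
  · rintro ⟨hv, hi, hj⟩
    exact Or.inr (Or.inl ⟨v, hv, i, j, hij, hi, hj, rfl⟩)

lemma starEdge_mem_matchingOf {z : V} {i : Fin 3} :
    starEdge z i ∈ matchingOf idx inc E Z X C ↔ z ∈ X ∧ inc z i ∈ C := by
  rw [mem_matchingOf]
  constructor
  · rintro (⟨e', he', hC, heq⟩ | ⟨w, hw, a, b, hab, ha, hb, heq⟩ | ⟨w, hw, a, ha, heq⟩)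
    · exact absurd heq starEdge_ne_extEdge
    · exact absurd heq starEdge_ne_triEdge
    · simp only [starEdge, Sym2.eq_iff, Sum.inr.injEq, Sum.inl.injEq, Prod.mk.injEq,
        reduceCtorEq, false_and, or_false] at heq
      obtain ⟨rfl, -, rfl⟩ := heq
      exact ⟨hw, ha⟩
  · rintro ⟨hz, hi⟩
    exact Or.inr (Or.inr ⟨z, hz, i, hi, rfl⟩)

lemma freeEdges_matchingOf (h : IsPortMap G idx inc) (hE : ∀ e, e ∈ E ↔ e ∈ G.edgeSet)
    (hC : C ⊆ E) : freeEdges idx E (matchingOf idx inc E Z X C) = C := by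
  ext e
  rw [mem_freeEdges]
  constructor
  · rintro ⟨he, hn⟩
    rwa [extEdge_mem_matchingOf h hE he, not_not] at hn
  · intro he
    rw [extEdge_mem_matchingOf h hE (hC he), not_not]
    exact ⟨hC he, he⟩

lemma IsPMgadget.matchingOf_freeEdges (h : IsPortMap G idx inc)
    (hE : ∀ e, e ∈ E ↔ e ∈ G.edgeSet) (hX : X ⊆ Z) {M : Finset (Sym2 (HVert V))}
    (hM : IsPMgadget G idx Z X M) : matchingOf idx inc E Z X (freeEdges idx E M) = M := by
  have hincE : ∀ v i, inc v i ∈ E := fun v i => (hE _).2 (h.mem_edgeSet v i)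
  ext ε
  rw [mem_matchingOf]
  constructor
  · rintro (⟨e, he, hC, rfl⟩ | ⟨v, hv, i, j, hij, hi, hj, rfl⟩ | ⟨z, hz, i, hi, rfl⟩)
    · rw [mem_freeEdges] at hC
      tauto
    · exact (hM.triEdge_mem_iff h hX hv hij).2 ⟨(mem_freeEdges.1 hi).2, (mem_freeEdges.1 hj).2⟩
    · exact (hM.starEdge_mem_iff h hX hz).2 (mem_freeEdges.1 hi).2
  · intro hε
    rcases exists_eq_of_mem_gadgetGraph (hM.1 ε hε).1 with ⟨e, he, rfl⟩ |
      ⟨v, hv, i, j, hij, rfl⟩ | ⟨z, hz, i, rfl⟩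
    · exact Or.inl ⟨e, (hE e).2 he, fun hC => (mem_freeEdges.1 hC).2 hε, rfl⟩
    · obtain ⟨hi, hj⟩ := (hM.triEdge_mem_iff h hX hv hij).1 hε
      exact Or.inr (Or.inl ⟨v, hv, i, j, hij, mem_freeEdges.2 ⟨hincE _ _, hi⟩,
        mem_freeEdges.2 ⟨hincE _ _, hj⟩, rfl⟩)
    · have hzX : z ∈ X := (hM.1 _ hε).2 (Sum.inr z) (Sym2.mem_mk_left _ _)
      exact Or.inr (Or.inr ⟨z, hzX, i, mem_freeEdges.2 ⟨hincE _ _,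
        (hM.starEdge_mem_iff h hX hzX).1 hε⟩, rfl⟩)

lemma IsPMgadget.freeEdges_mem_links [DecidableEq V] (h : IsPortMap G idx inc)
    (hE : ∀ e, e ∈ E ↔ e ∈ G.edgeSet) (hX : X ⊆ Z) {M : Finset (Sym2 (HVert V))}
    (hM : IsPMgadget G idx Z X M) : freeEdges idx E M ∈ links E Z X := by
  classical
  have hincE : ∀ v i, inc v i ∈ freeEdges idx E M ↔ extEdge idx (inc v i) ∉ M := fun v i => by
    rw [mem_freeEdges, and_iff_right ((hE _).2 (h.mem_edgeSet v i))]
  have hdeg : ∀ v, edgeDeg (freeEdges idx E M) v =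
      (Finset.univ.filter fun i => extEdge idx (inc v i) ∉ M).card := by
    intro v
    rw [h.edgeDeg_eq (fun e he => (hE e).1 (mem_freeEdges.1 he).1) v]
    simp only [hincE]
  rw [mem_links]
  refine ⟨fun e he => (mem_freeEdges.1 he).1, fun v hv => ?_, fun z hz => ?_⟩
  · rw [hdeg]
    apply Fin.even_card_filter_three
    · intro i hi
      rcases hM.cover h hi with ⟨-, j, hj, ht⟩ | ⟨hvX, -⟩
      · exact ⟨j, hj, ((hM.triEdge_mem_iff h hX hv hj.symm).1 ht).2⟩
      · exact absurd (hX hvX) hv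
    · intro hall
      have h1 := (hM.triEdge_mem_iff h hX hv (show (0 : Fin 3) ≠ 1 by decide)).2
        ⟨hall 0, hall 1⟩
      have h2 := (hM.triEdge_mem_iff h hX hv (show (0 : Fin 3) ≠ 2 by decide)).2
        ⟨hall 0, hall 2⟩
      have := triEdge_injective (hM.eq_of_mem (inl_mem_gadgetVerts (v, 0)) h1 h2
        (Sym2.mem_mk_left _ _) (Sym2.mem_mk_left _ _))
      exact absurd this (by decide)
  · rw [hdeg]
    split_ifs with hzX
    · obtain ⟨ε, hε, hzε⟩ := (hM.2 (Sum.inr z) hzX).exists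
      obtain ⟨i, rfl⟩ := eq_of_inr_mem (hM.1 ε hε).1 hzε
      rw [Finset.card_eq_one]
      refine ⟨i, ?_⟩
      ext j
      rw [Finset.mem_filter, Finset.mem_singleton, ← hM.starEdge_mem_iff h hX hzX]
      simp only [Finset.mem_univ, true_and]
      constructor
      · intro hj
        exact starEdge_injective (hM.eq_of_mem (x := Sum.inr z) hzX hj hε
          (Sym2.mem_mk_left _ _) (Sym2.mem_mk_left _ _))
      · rintro rfl
        exact hε
    · rw [Finset.card_eq_zero, Finset.filter_eq_empty_iff]
      intro i _ hi
      rcases hM.cover h hi with ⟨hz', -⟩ | ⟨hz', -⟩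
      · exact hz' hz
      · exact hzX hz'

lemma isPMgadget_matchingOf [DecidableEq V] (h : IsPortMap G idx inc)
    (hE : ∀ e, e ∈ E ↔ e ∈ G.edgeSet) (hX : X ⊆ Z) (hC : C ∈ links E Z X) :
    IsPMgadget G idx Z X (matchingOf idx inc E Z X C) := by
  have hincE : ∀ v i, inc v i ∈ E := fun v i => (hE _).2 (h.mem_edgeSet v i)
  obtain ⟨hCE, heven, hZ⟩ := mem_links.1 hC
  have hdeg := h.edgeDeg_eq fun e he => (hE e).1 (hCE he)
  have hedge : ∀ ε ∈ matchingOf idx inc E Z X C, ε ∈ (gadgetGraph G idx Z).edgeSet ∧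
      ∀ x ∈ ε, x ∈ gadgetVerts X := by
    intro ε hε
    rcases mem_matchingOf.1 hε with ⟨e, he, -, rfl⟩ | ⟨v, hv, i, j, hij, -, -, rfl⟩ |
      ⟨z, hz, i, -, rfl⟩
    · refine ⟨extEdge_mem_gadgetGraph Z ((hE e).1 he), ?_⟩
      rintro (x | x) hx
      · exact inl_mem_gadgetVerts x
      · exact absurd hx inr_notMem_extEdge
    · refine ⟨triEdge_mem_gadgetGraph hv hij, ?_⟩
      rintro (x | x) hx
      · exact inl_mem_gadgetVerts x
      · simp at hx
    · refine ⟨starEdge_mem_gadgetGraph (hX hz) i, ?_⟩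
      rintro (x | x) hx
      · exact inl_mem_gadgetVerts x
      · simp only [Sym2.mem_iff, Sum.inr.injEq, reduceCtorEq, or_false] at hx
        rw [hx]
        exact hz
  refine ⟨hedge, ?_⟩
  rintro (⟨v, i⟩ | z) hx
  · by_cases hi : inc v i ∈ C
    · by_cases hv : v ∈ Z
      · have hvX : v ∈ X := by
          by_contra hvX
          have h0 := hZ v hv
          rw [if_neg hvX, hdeg, Finset.card_eq_zero, Finset.filter_eq_empty_iff] at h0
          exact h0 (Finset.mem_univ i) hi
        refine ⟨starEdge v i, ⟨starEdge_mem_matchingOf.2 ⟨hvX, hi⟩, Sym2.mem_mk_right _ _⟩, ?_⟩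
        rintro ε ⟨hε, hvε⟩
        rcases h.eq_of_inl_mem (hedge ε hε).1 hvε with rfl | ⟨hv', -⟩ | ⟨-, rfl⟩
        · exact absurd hi ((extEdge_mem_matchingOf h hE (hincE v i)).1 hε)
        · exact absurd hv hv'
        · rfl
      · have hev := heven v hv
        rw [hdeg] at hev
        obtain ⟨j, hji, hj, huniq⟩ := Fin.existsUnique_of_even_card_three _ hev hi
        refine ⟨triEdge v i j, ⟨(triEdge_mem_matchingOf h hE hji.symm).2 ⟨hv, hi, hj⟩,
          Sym2.mem_mk_left _ _⟩, ?_⟩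
        rintro ε ⟨hε, hvε⟩
        rcases h.eq_of_inl_mem (hedge ε hε).1 hvε with rfl | ⟨-, k, hki, rfl⟩ | ⟨hv', -⟩
        · exact absurd hi ((extEdge_mem_matchingOf h hE (hincE v i)).1 hε)
        · rw [huniq k hki ((triEdge_mem_matchingOf h hE hki.symm).1 hε).2.2]
        · exact absurd hv' hv
    · refine ⟨extEdge idx (inc v i), ⟨(extEdge_mem_matchingOf h hE (hincE v i)).2 hi,
        (h.inl_mem_extEdge_iff (h.mem_edgeSet v i)).2 rfl⟩, ?_⟩
      rintro ε ⟨hε, hvε⟩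
      rcases h.eq_of_inl_mem (hedge ε hε).1 hvε with rfl | ⟨-, k, hki, rfl⟩ | ⟨-, rfl⟩
      · rfl
      · exact absurd ((triEdge_mem_matchingOf h hE hki.symm).1 hε).2.1 hi
      · exact absurd (starEdge_mem_matchingOf.1 hε).2 hi
  · have hz : z ∈ X := hx
    have h1 := hZ z (hX hz)
    rw [if_pos hz, hdeg, Finset.card_eq_one] at h1
    obtain ⟨i, hi⟩ := h1
    have hmem : ∀ j, inc z j ∈ C ↔ j = i := fun j => by
      rw [← Finset.mem_singleton, ← hi, Finset.mem_filter]
      simp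
    refine ⟨starEdge z i, ⟨starEdge_mem_matchingOf.2 ⟨hz, (hmem i).2 rfl⟩,
      Sym2.mem_mk_left _ _⟩, ?_⟩
    rintro ε ⟨hε, hzε⟩
    obtain ⟨j, rfl⟩ := eq_of_inr_mem (hedge ε hε).1 hzε
    rw [(hmem j).1 (starEdge_mem_matchingOf.1 hε).2]

/-- The perfect matchings of `H(X)` correspond to the members of `links E Z X`. -/
theorem pmPoly_eq_sum_links [DecidableEq V] (h : IsPortMap G idx inc)
    (hE : ∀ e, e ∈ E ↔ e ∈ G.edgeSet) (ℓ : Sym2 V → ℕ) (hX : X ⊆ Z) :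
    pmPoly G ℓ idx Z X = ∑ C ∈ links E Z X, Polynomial.X ^ (∑ e ∈ E \ C, ℓ e) := by
  classical
  rw [pmPoly]
  refine Finset.sum_nbij' (freeEdges idx E) (matchingOf idx inc E Z X) ?_ ?_ ?_ ?_ ?_
  · exact fun M hM => (Finset.mem_filter.1 hM).2.freeEdges_mem_links h hE hX
  · exact fun C hC => Finset.mem_filter.2 ⟨Finset.mem_univ _, isPMgadget_matchingOf h hE hX hC⟩
  · exact fun M hM => (Finset.mem_filter.1 hM).2.matchingOf_freeEdges h hE hX
  · exact fun C hC => freeEdges_matchingOf h hE (mem_links.1 hC).1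
  · exact fun M _ => prod_wt h hE ℓ M

end GadgetMatchings

lemma lengthOf_coe {V : Type} {ℓ : Sym2 V → ℕ} (D : Finset (Sym2 V)) : lengthOf ℓ (D : Set (Sym2 V)) = ∑ e ∈ D, ℓ e :=
  finsum_mem_coe_finset ℓ D

lemma IsSolution.subset_edgeSet {V : Type} [DecidableEq V] {G : SimpleGraph V}
    {A B : Finset V} {E' : Set (Sym2 V)} (h : IsSolution G A B E') :
    E' ⊆ G.edgeSet := by
  obtain ⟨k, f, -, -, -, -, -, rfl⟩ := h
  exact Set.iUnion_subset fun i e he => (f i).2.2.edges_subset_edgeSet he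

lemma totalLen_eq {V : Type} {G : SimpleGraph V} {ℓ : Sym2 V → ℕ} {E : Finset (Sym2 V)}
    (hE : ∀ e, e ∈ E ↔ e ∈ G.edgeSet) : totalLen G ℓ = ∑ e ∈ E, ℓ e := by
  rw [totalLen, ← finsum_mem_coe_finset]
  congr! 3 with e
  exact (hE e).symm

lemma lAB_le {V : Type} [DecidableEq V] {G : SimpleGraph V} {A B : Finset V} {ℓ : Sym2 V → ℕ}
    {D : Finset (Sym2 V)} (hD : IsSolution G A B (D : Set (Sym2 V))) :
    lAB G A B ℓ ≤ ∑ e ∈ D, ℓ e :=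
  Nat.sInf_le ⟨_, hD, lengthOf_coe D⟩

section Coefficients

variable {V : Type} [Fintype V] [DecidableEq V] {G : SimpleGraph V} {A B : Finset V}
  {ℓ : Sym2 V → ℕ} {idx : V → Sym2 V → Fin 3} {inc : V → Fin 3 → Sym2 V} {E : Finset (Sym2 V)}

lemma filter_linkPairs_eq_product {Z X : Finset V} (hX : X ⊆ Z) :
    (linkPairs E Z).filter (fun c => Z.filter (fun z => edgeDeg c.1 z = 1) = X) =
      links E Z X ×ˢ links E Z (Z \ X) := by
  ext ⟨C₁, C₂⟩
  rw [Finset.mem_filter, mem_linkPairs, Finset.mem_product, mem_links, mem_links]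
  constructor
  · rintro ⟨⟨h1, h2, heven, hone⟩, rfl⟩
    refine ⟨⟨h1, fun v hv => (heven v hv).1, fun z hz => ?_⟩, h2, fun v hv => (heven v hv).2,
      fun z hz => ?_⟩
    · have := hone z hz
      dsimp only at this ⊢
      split_ifs with h <;> simp only [Finset.mem_filter, hz, true_and] at h <;> omega
    · have := hone z hz
      dsimp only at this ⊢
      split_ifs with h <;> simp only [Finset.mem_sdiff, Finset.mem_filter, hz, true_and] at h <;>
        omega
  · rintro ⟨⟨h1, heven1, hone1⟩, h2, heven2, hone2⟩
    refine ⟨⟨h1, h2, fun v hv => ⟨heven1 v hv, heven2 v hv⟩, fun z hz => ?_⟩, ?_⟩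
    · dsimp only at *
      rw [hone1 z hz, hone2 z hz]
      by_cases hzX : z ∈ X <;> simp [hzX, hz]
    · ext z
      rw [Finset.mem_filter]
      constructor
      · rintro ⟨hz, h⟩
        dsimp only at h
        rw [hone1 z hz] at h
        by_contra hzX
        simp [hzX] at h
      · intro hz
        refine ⟨hX hz, ?_⟩
        dsimp only
        rw [hone1 z (hX hz), if_pos hz]

lemma pPoly_eq_sum_linkPairs (h : IsPortMap G idx inc) (hE : ∀ e, e ∈ E ↔ e ∈ G.edgeSet) :
    pPoly G A B ℓ idx = ∑ c ∈ linkPairs E (A ∪ B),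
      Polynomial.C (linkSign A c.1) *
        Polynomial.X ^ (∑ e ∈ E \ c.1, ℓ e + ∑ e ∈ E \ c.2, ℓ e) := by
  rw [pPoly, ← Finset.sum_fiberwise_of_maps_to (s := linkPairs E (A ∪ B))
    (g := fun c => (A ∪ B).filter (fun z => edgeDeg c.1 z = 1)) (t := (A ∪ B).powerset)
    fun c _ => Finset.mem_powerset.2 (Finset.filter_subset _ _)]
  refine Finset.sum_congr rfl fun X hX => ?_
  have hXZ := Finset.mem_powerset.1 hX
  rw [pmPoly_eq_sum_links h hE ℓ hXZ, pmPoly_eq_sum_links h hE ℓ Finset.sdiff_subset,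
    Finset.sum_mul_sum, ← Finset.sum_product', Finset.mul_sum, ← filter_linkPairs_eq_product hXZ]
  refine Finset.sum_congr rfl fun c hc => ?_
  have hXc := (Finset.mem_filter.1 hc).2
  have hcard : X ∩ A = A.filter fun a => edgeDeg c.1 a = 1 := by
    rw [← hXc]
    ext a
    simp only [Finset.mem_inter, Finset.mem_filter, Finset.mem_union]
    tauto
  rw [hcard, linkSign, pow_add]
  simp

lemma coeff_pPoly (h : IsPortMap G idx inc) (hE : ∀ e, e ∈ E ↔ e ∈ G.edgeSet) (k : ℕ) :
    (pPoly G A B ℓ idx).coeff k =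
      ∑ c ∈ (linkPairs E (A ∪ B)).filter
        (fun c => ∑ e ∈ c.1, ℓ e + ∑ e ∈ c.2, ℓ e + k = 2 * ∑ e ∈ E, ℓ e), linkSign A c.1 := by
  rw [pPoly_eq_sum_linkPairs h hE, Polynomial.finsetSum_coeff, Finset.sum_filter]
  refine Finset.sum_congr rfl fun c hc => ?_
  obtain ⟨h1, h2, -⟩ := mem_linkPairs.1 hc
  have e1 := Finset.sum_sdiff (f := ℓ) h1
  have e2 := Finset.sum_sdiff (f := ℓ) h2
  rw [Polynomial.coeff_C_mul_X_pow]
  split_ifs <;> first | rfl | omega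

lemma exists_isSolution_lAB (hsol : ∃ E', IsSolution G A B E') :
    ∃ D : Finset (Sym2 V), IsSolution G A B (D : Set (Sym2 V)) ∧ ∑ e ∈ D, ℓ e = lAB G A B ℓ := by
  classical
  obtain ⟨E', hE'⟩ := hsol
  obtain ⟨E₀, h0, h1⟩ := Nat.sInf_mem (s := {n | ∃ E', IsSolution G A B E' ∧ lengthOf ℓ E' = n})
    ⟨_, E', hE', rfl⟩
  refine ⟨E₀.toFinset, by rwa [Set.coe_toFinset], ?_⟩
  rw [← lengthOf_coe, Set.coe_toFinset, h1, lAB]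

open Classical in
lemma nSol_eq_card : nSol G A B ℓ = (Finset.univ.filter fun D : Finset (Sym2 V) =>
    IsSolution G A B (D : Set (Sym2 V)) ∧ ∑ e ∈ D, ℓ e = lAB G A B ℓ).card := by
  rw [nSol, ← Finset.card_image_of_injective _ Finset.coe_injective, ← Set.ncard_coe_finset]
  congr 1
  ext E'
  simp only [Set.mem_ofPred_eq, Finset.coe_image, Finset.coe_filter, Finset.mem_univ, true_and,
    Set.mem_image]
  constructor
  · rintro ⟨h1, h2⟩
    refine ⟨E'.toFinset, ⟨by rwa [Set.coe_toFinset], ?_⟩, Set.coe_toFinset E'⟩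
    rw [← lengthOf_coe, Set.coe_toFinset, h2]
  · rintro ⟨D, ⟨h1, h2⟩, rfl⟩
    exact ⟨h1, by rw [lengthOf_coe, h2]⟩

end Coefficients

/-!
STATEMENT 2.  If a solution to Disjoint `A`,`B`-paths on the cubic graph `G` exists,
then in `p(G,s) ∈ ℤ[s]` the coefficient of `s^k` vanishes for every
`k > 2Λ − ℓ_{A,B}`, and the coefficient of `s^{2Λ−ℓ_{A,B}}` equals
`2^{|Z|/2} · S_{A,B}`.  In particular, if `c·s^d` is the monomial of largest degree
in `p(G,s)` having a positive coefficient, then `ℓ_{A,B} = 2Λ − d` and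
`S_{A,B} = c / 2^{|Z|/2}`.
-/
theorem stmt2 {V : Type} [Fintype V] [DecidableEq V]
    (G : SimpleGraph V) (A B : Finset V) (ℓ : Sym2 V → ℕ)
    (idx : V → Sym2 V → Fin 3)
    (hdisj : Disjoint A B) (hA : Even A.card) (hB : Even B.card)
    (hcubic : ∀ v : V, (G.neighborSet v).ncard = 3)
    (hidx : ∀ v : V, Set.InjOn (idx v) (G.incidenceSet v))
    (hℓ : ∀ e ∈ G.edgeSet, 1 ≤ ℓ e)
    (hsol : ∃ E', IsSolution G A B E') :
    (∀ k : ℕ, 2 * totalLen G ℓ - lAB G A B ℓ < k → (pPoly G A B ℓ idx).coeff k = 0) ∧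
    (pPoly G A B ℓ idx).coeff (2 * totalLen G ℓ - lAB G A B ℓ) =
      (2 : ℤ) ^ ((A ∪ B).card / 2) * (nSol G A B ℓ : ℤ) ∧
    (∀ d : ℕ, 0 < (pPoly G A B ℓ idx).coeff d →
      (∀ k : ℕ, d < k → ¬ 0 < (pPoly G A B ℓ idx).coeff k) →
      lAB G A B ℓ = 2 * totalLen G ℓ - d ∧
      (pPoly G A B ℓ idx).coeff d =
        (2 : ℤ) ^ ((A ∪ B).card / 2) * (nSol G A B ℓ : ℤ)) := by
  classical
  obtain ⟨inc, h⟩ := exists_isPortMap hcubic hidx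
  obtain ⟨E, hE⟩ : ∃ E : Finset (Sym2 V), ∀ e, e ∈ E ↔ e ∈ G.edgeSet :=
    ⟨Finset.univ.filter (· ∈ G.edgeSet), by simp⟩
  have hdeg : ∀ v, edgeDeg E v ≤ 3 := fun v => by
    rw [h.edgeDeg_eq (fun e => (hE e).1) v]
    exact (Finset.card_le_univ _).trans_eq (Fintype.card_fin 3)
  have hℓE : ∀ e ∈ E, 1 ≤ ℓ e := fun e he => hℓ e ((hE e).1 he)
  obtain ⟨D, hD, hDl⟩ := exists_isSolution_lAB (ℓ := ℓ) hsol
  have hle : lAB G A B ℓ ≤ ∑ e ∈ E, ℓ e :=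
    hDl ▸ Finset.sum_le_sum_of_subset fun e he => (hE e).2 (hD.subset_edgeSet he)
  have hpos : 0 < nSol G A B ℓ := by
    rw [nSol_eq_card, Finset.card_pos]
    exact ⟨D, by simpa using ⟨hD, hDl⟩⟩
  rw [totalLen_eq hE]
  have hzero : ∀ k, 2 * (∑ e ∈ E, ℓ e) - lAB G A B ℓ < k → (pPoly G A B ℓ idx).coeff k = 0 := by
    intro k hk
    rw [coeff_pPoly h hE]
    by_cases hk2 : k ≤ 2 * ∑ e ∈ E, ℓ e
    · rw [← sum_linkSign_of_lt (fun e => (hE e).1) hdeg hℓE hdisj (fun D' hD' => lAB_le hD')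
        (show 2 * (∑ e ∈ E, ℓ e) - k < lAB G A B ℓ by omega)]
      refine Finset.sum_congr (Finset.filter_congr fun c _ => ?_) fun _ _ => rfl
      omega
    · rw [Finset.filter_false_of_mem, Finset.sum_empty]
      intro c _
      omega
  have htop : (pPoly G A B ℓ idx).coeff (2 * (∑ e ∈ E, ℓ e) - lAB G A B ℓ) =
      (2 : ℤ) ^ ((A ∪ B).card / 2) * (nSol G A B ℓ : ℤ) := by
    rw [coeff_pPoly h hE, nSol_eq_card,
      ← sum_linkSign_eq hE hdeg hℓE hdisj hA hB (fun D' hD' => lAB_le hD')]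
    refine Finset.sum_congr (Finset.filter_congr fun c _ => ?_) fun _ _ => rfl
    omega
  refine ⟨hzero, htop, fun d hd hmax => ?_⟩
  have hd_eq : d = 2 * (∑ e ∈ E, ℓ e) - lAB G A B ℓ := by
    rcases lt_trichotomy d (2 * (∑ e ∈ E, ℓ e) - lAB G A B ℓ) with hlt | heq | hgt
    · refine absurd ?_ (hmax _ hlt)
      rw [htop]
      positivity
    · exact heq
    · exact absurd (hzero d hgt) hd.ne'
  exact ⟨by omega, hd_eq ▸ htop⟩
end
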